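/- There exist R₀ > 0 and C ≥ 1 such that: if x, y ∈ Γ and v ∈ Γ lies on a geodesic segment α ∈ [x,y], then G_Δ(x,y) ≤ C · F_Δ(x,v) · G_Δ(v,y) for every subset Δ ⊂ Γ containing N(α,R₀). (Almost multiplicativity of the Green function along geodesics, uniformly over restrictions of the walk.) -/

import Mathlib

open Filter Topology MeasureTheory
open scoped ENNReal

namespace HarmonicBoundary

variable {Γ : Type} [Group Γ]

/-- Word length of `g` with respect to a generating set `S`. -/
noncomputable def wl (S : Set Γ) (g : Γ) : ℕ :=
  sInf {n : ℕ | ∃ w : List Γ, w.length = n ∧ (∀ x ∈ w, x ∈ S) ∧ w.prod = g}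

/-- Word metric `d(x,y) = |x⁻¹y|`. -/
noncomputable def wdist (S : Set Γ) (x y : Γ) : ℕ := wl S (x⁻¹ * y)

/-- Gromov product `(x|y)_z = (d(x,z)+d(y,z)-d(x,y))/2`. -/
noncomputable def gp (S : Set Γ) (z x y : Γ) : ℝ :=
  ((wdist S x z : ℝ) + (wdist S y z : ℝ) - (wdist S x y : ℝ)) / 2

/-- `S` is a finite symmetric generating set of `Γ`. -/
def IsGenSet (S : Set Γ) : Prop :=
  S.Finite ∧ (∀ s ∈ S, s⁻¹ ∈ S) ∧ Subgroup.closure S = ⊤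

/-- `Γ` is `δ`-hyperbolic with respect to the word metric of `S`:
`(x|y) ≥ min ((x|z), (y|z)) - δ` for all `x y z`. -/
def IsHyperbolic (S : Set Γ) (δ : ℝ) : Prop :=
  0 ≤ δ ∧ ∀ x y z : Γ, min (gp S 1 x z) (gp S 1 y z) - δ ≤ gp S 1 x y

/-- `Γ` is nonelementary: it has no cyclic subgroup of finite index. -/
def Nonelementary (Γ : Type) [Group Γ] : Prop :=
  ∀ g : Γ, (Subgroup.zpowers g).index = 0

/-- A sequence converges to infinity if `(x_i|x_j) → ∞`. -/
def ConvInf (S : Set Γ) (u : ℕ → Γ) : Prop :=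
  Tendsto (fun p : ℕ × ℕ => gp S 1 (u p.1) (u p.2)) atTop atTop

/-- Two sequences converging to infinity are equivalent if `(x_i|y_j) → ∞`. -/
def EquivSeq (S : Set Γ) (u v : ℕ → Γ) : Prop :=
  Tendsto (fun p : ℕ × ℕ => gp S 1 (u p.1) (v p.2)) atTop atTop

/-- An (abstract model of the) Gromov boundary of `Γ`: the points are exactly the
classes of sequences converging to infinity, modulo the equivalence `EquivSeq`,
together with the natural left action of `Γ`. -/
structure Boundary (Γ : Type) [Group Γ] (S : Set Γ) where
  pt : Type
  cls : (ℕ → Γ) → pt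
  cls_surj : ∀ ξ : pt, ∃ u : ℕ → Γ, ConvInf S u ∧ cls u = ξ
  cls_eq : ∀ u v : ℕ → Γ, ConvInf S u → ConvInf S v → (cls u = cls v ↔ EquivSeq S u v)
  smul : Γ → pt → pt
  smul_cls : ∀ (g : Γ) (u : ℕ → Γ), ConvInf S u → smul g (cls u) = cls fun n => g * u n

/-- Extension of the Gromov product to the boundary:
`(ξ|η) = sup liminf (x_i|y_j)` over sequences representing `ξ` and `η`,
as an extended nonnegative real. -/
noncomputable def bgp {S : Set Γ} (B : Boundary Γ S) (ξ η : B.pt) : ℝ≥0∞ :=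
  ⨆ (u : {u : ℕ → Γ // ConvInf S u ∧ B.cls u = ξ})
    (v : {v : ℕ → Γ // ConvInf S v ∧ B.cls v = η}),
    Filter.liminf (fun p : ℕ × ℕ => ENNReal.ofReal (gp S 1 (u.1 p.1) (v.1 p.2))) atTop

/-- Real-valued Gromov product on the boundary (finite for `ξ ≠ η`). -/
noncomputable def bgpR {S : Set Γ} (B : Boundary Γ S) (ξ η : B.pt) : ℝ := (bgp B ξ η).toReal

/-- The canonical topology of the Gromov boundary: a set is open iff around each of
its points it contains a basic neighbourhood `V_r(p) = {q | (q|p) > r}`. -/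
def btop {S : Set Γ} (B : Boundary Γ S) : TopologicalSpace B.pt where
  IsOpen O := ∀ p ∈ O, ∃ r : ℝ≥0∞, r ≠ ⊤ ∧ {q | r < bgp B q p} ⊆ O
  isOpen_univ := fun p _ => ⟨0, ENNReal.zero_ne_top, fun q _ => trivial⟩
  isOpen_inter := by
    intro A A' hA hA' p hp
    obtain ⟨r1, hr1, h1⟩ := hA p hp.1
    obtain ⟨r2, hr2, h2⟩ := hA' p hp.2
    refine ⟨max r1 r2, (max_lt hr1.lt_top hr2.lt_top).ne, fun q hq => ?_⟩
    have hq' : max r1 r2 < bgp B q p := hq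
    exact ⟨h1 (show r1 < bgp B q p from (le_max_left r1 r2).trans_lt hq'),
      h2 (show r2 < bgp B q p from (le_max_right r1 r2).trans_lt hq')⟩
  isOpen_sUnion := by
    intro s hs p hp
    obtain ⟨t, ht, hpt⟩ := hp
    obtain ⟨r, hr, hsub⟩ := hs t ht p hpt
    exact ⟨r, hr, fun q hq => ⟨t, ht, hsub hq⟩⟩

/-- The attracting fixed point `g⁺ = lim_n gⁿ` of an (infinite order) element. -/
def plusPt {S : Set Γ} (B : Boundary Γ S) (g : Γ) : B.pt := B.cls fun n => g ^ n

/-- The repelling fixed point `g⁻ = lim_n g⁻ⁿ` of an (infinite order) element. -/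
def minusPt {S : Set Γ} (B : Boundary Γ S) (g : Γ) : B.pt := B.cls fun n => g⁻¹ ^ n

/-- A geodesic ray starting at the identity. -/
def IsGeodesicRay (S : Set Γ) (x : ℕ → Γ) : Prop :=
  x 0 = 1 ∧ ∀ m n : ℕ, wdist S (x m) (x n) = Nat.dist m n

/-- A geodesic ray from `e` to the boundary point `ξ`, i.e. an element of `[e,ξ]`. -/
def RayTo {S : Set Γ} (B : Boundary Γ S) (x : ℕ → Γ) (ξ : B.pt) : Prop :=
  IsGeodesicRay S x ∧ ConvInf S x ∧ B.cls x = ξ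

/-- A geodesic segment from `x` to `y` (parametrized on `0,…,d(x,y)`),
i.e. an element of `[x,y]`. -/
def IsGeodesicSeg (S : Set Γ) (x y : Γ) (α : ℕ → Γ) : Prop :=
  α 0 = x ∧ α (wdist S x y) = y ∧
  ∀ m n : ℕ, m ≤ wdist S x y → n ≤ wdist S x y → wdist S (α m) (α n) = Nat.dist m n

/-- The boundary "cylinder" `U(ξ,R)`: all `η` such that for every pair of geodesic
rays `x ∈ [e,ξ]`, `y ∈ [e,η]` one has `lim_n (x(n)|y(n)) > R` (the sequence
`(x(n)|y(n))` is nondecreasing, so the limit exceeds `R` iff some term does). -/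
def Uset {S : Set Γ} (B : Boundary Γ S) (ξ : B.pt) (R : ℝ) : Set B.pt :=
  {η | ∀ x y : ℕ → Γ, RayTo B x ξ → RayTo B y η → ∃ n : ℕ, R < gp S 1 (x n) (y n)}

/-- `C_r(p) = {g | (g|e)_p > r}`. -/
def Cset (S : Set Γ) (p : Γ) (r : ℝ) : Set Γ := {g | r < gp S p g 1}

/-- The `R`-neighbourhood `N(α,R)` of a geodesic segment `α ∈ [x,y]`. -/
def segN (S : Set Γ) (x y : Γ) (α : ℕ → Γ) (R : ℝ) : Set Γ :=
  {g | ∃ i ≤ wdist S x y, (wdist S g (α i) : ℝ) ≤ R}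

/-- The `R`-neighbourhood `N(A,R)` of a subset `A ⊆ Γ`. -/
def setN (S : Set Γ) (A : Set Γ) (R : ℝ) : Set Γ :=
  {g | ∃ a ∈ A, (wdist S g a : ℝ) ≤ R}

/-- `μ` is a nondegenerate probability measure on `Γ` with support contained in `S`:
nonnegative, of total mass one, supported in `S`, and the semigroup generated by its
support is the whole of `Γ`. -/
structure IsRWMeasure (S : Set Γ) (μ : Γ → ℝ) : Prop where
  nonneg : ∀ g, 0 ≤ μ g
  support_subset : ∀ g, μ g ≠ 0 → g ∈ S
  total : ∑' g : Γ, μ g = 1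
  nondeg : ∀ g : Γ, ∃ l : List Γ, l ≠ [] ∧ (∀ x ∈ l, 0 < μ x) ∧ l.prod = g

open Classical in
/-- `n`-step transition probabilities `p⁽ⁿ⁾(x,y) = μ*ⁿ(x⁻¹y)` of the random walk. -/
noncomputable def ptrans (μ : Γ → ℝ) : ℕ → Γ → Γ → ℝ
  | 0 => fun x y => if x = y then 1 else 0
  | n + 1 => fun x y => ∑' z : Γ, ptrans μ n x z * μ (z⁻¹ * y)

/-- Green function `G(x,y) = Σ_n p⁽ⁿ⁾(x,y)`. -/
noncomputable def green (μ : Γ → ℝ) (x y : Γ) : ℝ := ∑' n : ℕ, ptrans μ n x y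

/-- `F(x,y) = G(x,y)/G(y,y)`, the probability that the walk from `x` ever hits `y`. -/
noncomputable def greenF (μ : Γ → ℝ) (x y : Γ) : ℝ := green μ x y / green μ y y

/-- The Martin kernel `K(x,y) = G(x,y)/G(e,y)`. -/
noncomputable def martinK (μ : Γ → ℝ) (x y : Γ) : ℝ := green μ x y / green μ 1 y

open Classical in
/-- Transition probabilities of the walk restricted to `Δ` (killed when leaving `Δ`). -/
noncomputable def ptransR (μ : Γ → ℝ) (Δ : Set Γ) : ℕ → Γ → Γ → ℝ
  | 0 => fun x y => if x = y ∧ x ∈ Δ then 1 else 0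
  | n + 1 => fun x y => if y ∈ Δ then ∑' z : Γ, ptransR μ Δ n x z * μ (z⁻¹ * y) else 0

/-- Green function `G_Δ` of the restricted walk. -/
noncomputable def greenR (μ : Γ → ℝ) (Δ : Set Γ) (x y : Γ) : ℝ := ∑' n : ℕ, ptransR μ Δ n x y

/-- `F_Δ(x,y) = G_Δ(x,y)/G_Δ(y,y)`. -/
noncomputable def greenFR (μ : Γ → ℝ) (Δ : Set Γ) (x y : Γ) : ℝ :=
  greenR μ Δ x y / greenR μ Δ y y

/-- Generating function `G_Δ(x,y|z) = Σ_n p_Δ⁽ⁿ⁾(x,y) zⁿ`. -/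
noncomputable def greenRZ (μ : Γ → ℝ) (Δ : Set Γ) (x y : Γ) (z : ℝ) : ℝ :=
  ∑' n : ℕ, ptransR μ Δ n x y * z ^ n

/-- Spectral radius `ρ(P) = lim_n p⁽ⁿ⁾(e,e)^{1/n}` of the walk. -/
noncomputable def specRad (μ : Γ → ℝ) : ℝ :=
  Filter.limsup (fun n : ℕ => (ptrans μ n 1 1) ^ ((n : ℝ)⁻¹)) atTop

/-- `u` is harmonic on `Λ`: `Σ_h p(g,h) u(h) = u(g)` for `g ∈ Λ`, `p(g,h)=μ(g⁻¹h)`. -/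
def HarmonicOn (μ : Γ → ℝ) (u : Γ → ℝ) (Λ : Set Γ) : Prop :=
  ∀ g ∈ Λ, (∑' h : Γ, μ (g⁻¹ * h) * u h) = u g

/-- `u` vanishes at infinity on `Λ`: `u(g_n) → 0` along sequences in `Λ` with `|g_n|→∞`. -/
def VanishesAtInftyOn (S : Set Γ) (u : Γ → ℝ) (Λ : Set Γ) : Prop :=
  ∀ ε : ℝ, 0 < ε → ∃ M : ℕ, ∀ g ∈ Λ, M ≤ wl S g → |u g| ≤ ε

open Classical in
/-- `r(g) = K(g⁻¹,g⁺)` for infinite order `g`, and `r(g) = 1` for finite order `g`;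
here `Kb` is the boundary extension of the Martin kernel. -/
noncomputable def rfun {S : Set Γ} (B : Boundary Γ S) (Kb : Γ → B.pt → ℝ) (g : Γ) : ℝ :=
  if IsOfFinOrder g then 1 else Kb g⁻¹ (plusPt B g)

/-- The ratio set `r(Γ,∂Γ,ν)`: all `l ≥ 0` such that for every `ε > 0` and every
Borel `A` of positive measure there is `g ∈ Γ` such that
`{ω ∈ gA ∩ A : |d(gν)/dν(ω) − l| < ε}` has positive measure; here the
Radon–Nikodym derivative `d(gν)/dν` is the Martin kernel `Kb g`. -/
def ratioSet {S : Set Γ} (B : Boundary Γ S) [MeasurableSpace B.pt]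
    (ν : Measure B.pt) (Kb : Γ → B.pt → ℝ) : Set ℝ :=
  {l : ℝ | 0 ≤ l ∧ ∀ ε : ℝ, 0 < ε → ∀ A : Set B.pt, MeasurableSet A → 0 < ν A →
    ∃ g : Γ, 0 < ν {ω | ω ∈ A ∧ B.smul g⁻¹ ω ∈ A ∧ |Kb g ω - l| < ε}}

/-- A left invariant finitely additive mean on `Γ`; `Γ` is amenable iff one exists. -/
structure InvariantMean (Γ : Type) [Group Γ] where
  m : Set Γ → ℝ
  nonneg : ∀ A, 0 ≤ m A
  total : m Set.univ = 1
  fin_add : ∀ A B : Set Γ, Disjoint A B → m (A ∪ B) = m A + m B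
  invariant : ∀ (g : Γ) (A : Set Γ), m ((g * ·) ⁻¹' A) = m A



/-! ### Word metric basics -/

lemma wl_le_of_list {S : Set Γ} (w : List Γ) (hw : ∀ x ∈ w, x ∈ S) : wl S w.prod ≤ w.length :=
  Nat.sInf_le ⟨w, rfl, hw, rfl⟩

lemma exists_list {S : Set Γ} (hS : IsGenSet S) (g : Γ) :
    ∃ w : List Γ, (∀ x ∈ w, x ∈ S) ∧ w.prod = g := by
  have hg : g ∈ Subgroup.closure S := by rw [hS.2.2]; trivial
  rw [← Subgroup.mem_toSubmonoid, Subgroup.closure_toSubmonoid] at hg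
  obtain ⟨l, hl, hp⟩ := Submonoid.exists_list_of_mem_closure hg
  refine ⟨l, fun x hx => ?_, hp⟩
  rcases hl x hx with h | h
  · exact h
  · simpa using hS.2.1 _ h

lemma wl_spec {S : Set Γ} (hS : IsGenSet S) (g : Γ) :
    ∃ w : List Γ, w.length = wl S g ∧ (∀ x ∈ w, x ∈ S) ∧ w.prod = g := by
  obtain ⟨w, h1, h2⟩ := exists_list hS g
  exact Nat.sInf_mem (s := {n : ℕ | ∃ w : List Γ, w.length = n ∧ (∀ x ∈ w, x ∈ S) ∧ w.prod = g})
    ⟨w.length, w, rfl, h1, h2⟩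

lemma wl_one {S : Set Γ} : wl S (1 : Γ) = 0 := by
  have := wl_le_of_list (S := S) ([] : List Γ) (by simp)
  simpa using this

lemma wl_gen {S : Set Γ} {s : Γ} (hs : s ∈ S) : wl S s ≤ 1 := by
  have := wl_le_of_list (S := S) [s] (by simpa using hs)
  simpa using this

lemma wl_mul {S : Set Γ} (hS : IsGenSet S) (g h : Γ) : wl S (g * h) ≤ wl S g + wl S h := by
  obtain ⟨a, ha, ha', rfl⟩ := wl_spec hS g
  obtain ⟨b, hb, hb', rfl⟩ := wl_spec hS h
  rw [← ha, ← hb, ← List.prod_append, ← List.length_append]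
  apply wl_le_of_list
  intro x hx
  rcases List.mem_append.1 hx with h | h
  · exact ha' x h
  · exact hb' x h

lemma wl_inv_le {S : Set Γ} (hS : IsGenSet S) (g : Γ) : wl S g⁻¹ ≤ wl S g := by
  obtain ⟨a, ha, ha', rfl⟩ := wl_spec hS g
  rw [← ha, List.prod_inv_reverse]
  refine (wl_le_of_list _ ?_).trans (by simp)
  intro x hx
  simp only [List.mem_reverse, List.mem_map] at hx
  obtain ⟨y, hy, rfl⟩ := hx
  exact hS.2.1 _ (ha' y hy)

lemma wl_inv {S : Set Γ} (hS : IsGenSet S) (g : Γ) : wl S g⁻¹ = wl S g :=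
  le_antisymm (wl_inv_le hS g) (by simpa using wl_inv_le hS g⁻¹)

lemma wl_eq_zero {S : Set Γ} (hS : IsGenSet S) {g : Γ} (h : wl S g = 0) : g = 1 := by
  obtain ⟨a, ha, _, rfl⟩ := wl_spec hS g
  rw [h, List.length_eq_zero_iff] at ha
  simp [ha]

lemma wdist_self {S : Set Γ} (x : Γ) : wdist S x x = 0 := by simp [wdist, wl_one]

lemma wdist_comm {S : Set Γ} (hS : IsGenSet S) (x y : Γ) : wdist S x y = wdist S y x := by
  unfold wdist
  rw [← wl_inv hS]
  simp

lemma wdist_tri {S : Set Γ} (hS : IsGenSet S) (x y z : Γ) :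
    wdist S x z ≤ wdist S x y + wdist S y z := by
  unfold wdist
  have := wl_mul hS (x⁻¹ * y) (y⁻¹ * z)
  simpa [mul_assoc] using this

lemma wdist_left {S : Set Γ} (g x y : Γ) : wdist S (g * x) (g * y) = wdist S x y := by
  unfold wdist
  congr 1
  group

lemma wdist_one_left {S : Set Γ} (x : Γ) : wdist S 1 x = wl S x := by simp [wdist]

lemma wdist_one_right {S : Set Γ} (hS : IsGenSet S) (x : Γ) : wdist S x 1 = wl S x := by
  rw [wdist_comm hS, wdist_one_left]

lemma wdist_mul_gen {S : Set Γ} (x : Γ) {s : Γ} (hs : s ∈ S) : wdist S x (x * s) ≤ 1 := by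
  unfold wdist
  simpa using wl_gen hs

lemma ball_finite {S : Set Γ} (hS : IsGenSet S) (n : ℕ) : {g : Γ | wl S g ≤ n}.Finite := by
  induction n with
  | zero =>
    refine (Set.finite_singleton (1 : Γ)).subset ?_
    intro g hg
    exact wl_eq_zero hS (Nat.le_zero.1 hg)
  | succ n ih =>
    refine ((Set.Finite.mul hS.1 ih).union (Set.finite_singleton (1 : Γ))).subset ?_
    intro g hg
    obtain ⟨a, ha, ha', rfl⟩ := wl_spec hS g
    cases a with
    | nil => right; simp
    | cons s t =>
      left
      rw [List.prod_cons]
      refine Set.mul_mem_mul (ha' s (by simp)) ?_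
      have h1 := wl_le_of_list (S := S) t (fun x hx => ha' x (by simp [hx]))
      have h2 : wl S (s :: t).prod ≤ n + 1 := hg
      rw [← ha] at h2
      simp only [List.length_cons] at h2
      show wl S t.prod ≤ n
      omega

/-- A point at prescribed distance on a geodesic from `1` to `s`. -/
lemma exists_between {S : Set Γ} (hS : IsGenSet S) (s : Γ) (t : ℕ) (ht : t ≤ wl S s) :
    ∃ p : Γ, wl S p = t ∧ wdist S p s + t = wl S s := by
  obtain ⟨w, hl, hw, hp⟩ := wl_spec hS s
  have h1 : wl S (w.take t).prod ≤ t := by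
    refine (wl_le_of_list _ fun x hx => hw x (List.mem_of_mem_take hx)).trans ?_
    simp
  have h2 : wl S (w.drop t).prod ≤ wl S s - t := by
    refine (wl_le_of_list _ fun x hx => hw x (List.mem_of_mem_drop hx)).trans ?_
    simp [hl]
  have h3 : (w.take t).prod * (w.drop t).prod = s := by
    rw [← List.prod_append, List.take_append_drop, hp]
  have h4 : wdist S (w.take t).prod s = wl S (w.drop t).prod := by
    unfold wdist
    conv_lhs => rw [← h3]
    rw [inv_mul_cancel_left]
  have h5 := wl_mul hS (w.take t).prod (w.drop t).prod
  rw [h3] at h5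
  exact ⟨(w.take t).prod, by omega, by omega⟩

/-- Four point inequality. -/
lemma four_point {S : Set Γ} {δ : ℝ} (hδ : IsHyperbolic S δ) (x y z w : Γ) :
    (wdist S x y : ℝ) + wdist S z w ≤
      max ((wdist S x z : ℝ) + wdist S y w) ((wdist S y z : ℝ) + wdist S x w) + 2 * δ := by
  have h := hδ.2 (w⁻¹ * x) (w⁻¹ * y) (w⁻¹ * z)
  have e : ∀ a : Γ, wdist S (w⁻¹ * a) 1 = wdist S a w := by
    intro a
    rw [← wdist_left w]; simp
  unfold gp at h
  simp only [e, wdist_left] at h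
  rcases le_total (((wdist S x w : ℝ) + wdist S z w - wdist S x z) / 2)
    (((wdist S y w : ℝ) + wdist S z w - wdist S y z) / 2) with h1 | h1
  · rw [min_eq_left h1] at h
    have := le_max_left ((wdist S x z : ℝ) + wdist S y w) ((wdist S y z : ℝ) + wdist S x w)
    linarith
  · rw [min_eq_right h1] at h
    have := le_max_right ((wdist S x z : ℝ) + wdist S y w) ((wdist S y z : ℝ) + wdist S x w)
    linarith

lemma hyp_min {S : Set Γ} {δ : ℝ} (hS : IsGenSet S) (hδ : IsHyperbolic S δ) (w x y z : Γ) :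
    min (gp S w x z) (gp S w z y) - δ ≤ gp S w x y := by
  have h := four_point hδ x y z w
  have e := wdist_comm hS y z
  unfold gp
  rcases le_max_iff.1 (le_of_eq (rfl : max ((wdist S x z : ℝ) + wdist S y w)
    ((wdist S y z : ℝ) + wdist S x w) = _)) with h1 | h1
  · have h2 := min_le_left (((wdist S x w : ℝ) + wdist S z w - wdist S x z) / 2)
      (((wdist S z w : ℝ) + wdist S y w - wdist S z y) / 2)
    linarith
  · have h2 := min_le_right (((wdist S x w : ℝ) + wdist S z w - wdist S x z) / 2)
      (((wdist S z w : ℝ) + wdist S y w - wdist S z y) / 2)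
    rw [e] at h1 h
    linarith

lemma gp_comm {S : Set Γ} (hS : IsGenSet S) (w x y : Γ) : gp S w x y = gp S w y x := by
  unfold gp; rw [wdist_comm hS x y]; ring

lemma gp_left {S : Set Γ} (g w x y : Γ) : gp S (g * w) (g * x) (g * y) = gp S w x y := by
  unfold gp; simp only [wdist_left]

/-- change of base point -/
lemma gp_base {S : Set Γ} (hS : IsGenSet S) (w w' x y : Γ) :
    gp S w x y - wdist S w w' ≤ gp S w' x y := by
  unfold gp
  have h1 : (wdist S x w : ℝ) ≤ wdist S x w' + wdist S w w' := by
    rw [wdist_comm hS w w']; exact_mod_cast wdist_tri hS x w' w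
  have h2 : (wdist S y w : ℝ) ≤ wdist S y w' + wdist S w w' := by
    rw [wdist_comm hS w w']; exact_mod_cast wdist_tri hS y w' w
  linarith

lemma gp_nonneg {S : Set Γ} (hS : IsGenSet S) (w x y : Γ) : 0 ≤ gp S w x y := by
  unfold gp
  have h1 : (wdist S x y : ℝ) ≤ wdist S x w + wdist S y w := by
    rw [wdist_comm hS y w]; exact_mod_cast wdist_tri hS x w y
  linarith

lemma gp_le_left {S : Set Γ} (hS : IsGenSet S) (w x y : Γ) : gp S w x y ≤ wdist S x w := by
  unfold gp
  have h1 : (wdist S y w : ℝ) ≤ wdist S x y + wdist S x w := by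
    rw [wdist_comm hS x y]; exact_mod_cast wdist_tri hS y x w
  linarith

lemma gp_le_right {S : Set Γ} (hS : IsGenSet S) (w x y : Γ) : gp S w x y ≤ wdist S y w := by
  rw [gp_comm hS]; exact gp_le_left hS w y x


/-! ### Stabilizers of boundary points are virtually cyclic -/

lemma cocycle_pt {S : Set Γ} {δ : ℝ} (hS : IsGenSet S) (hδ : IsHyperbolic S δ) (g g' s : Γ)
    (h : (wl S g' : ℝ) ≤ gp S 1 s (g⁻¹ * s)) :
    |((wdist S (g * g') s : ℝ) - wl S s) - ((wdist S g s : ℝ) - wl S s)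
      - ((wdist S g' s : ℝ) - wl S s)| ≤ 2 * δ := by
  have e1 : wdist S (g * g') s = wdist S g' (g⁻¹ * s) := by
    rw [← wdist_left g⁻¹ (g * g') s]; simp
  have e2 : wdist S g s = wl S (g⁻¹ * s) := rfl
  have h1 := hyp_min hS hδ 1 g' (g⁻¹ * s) s
  have h2 := hyp_min hS hδ 1 g' s (g⁻¹ * s)
  have h3 := gp_le_left hS 1 g' s
  have h4 := gp_le_left hS 1 g' (g⁻¹ * s)
  rw [wdist_one_right hS] at h3 h4
  rw [min_eq_left (h3.trans h)] at h1
  rw [gp_comm hS 1 (g⁻¹ * s) s, min_eq_left (h4.trans h)] at h2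
  unfold gp at h1 h2
  simp only [wdist_one_right hS] at h1 h2
  rw [e1, e2, abs_le]
  constructor <;> linarith

lemma close_pt {S : Set Γ} {δ : ℝ} (hS : IsGenSet S) (hδ : IsHyperbolic S δ) (g p s : Γ) (t : ℕ)
    (hp : wl S p = t) (hps : wdist S p s + t = wl S s) (ht : (wl S g : ℝ) + 2 * δ < t)
    (h : 2 * (t : ℝ) + 2 * δ + 1 ≤ gp S 1 s (g⁻¹ * s)) :
    (wdist S p (g * p) : ℝ) ≤ |(wdist S g s : ℝ) - wl S s| + 8 * δ := by
  have hδ0 := hδ.1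
  have ht0 : (0 : ℝ) ≤ t := Nat.cast_nonneg t
  have hps' : (wdist S p s : ℝ) + t = wl S s := by exact_mod_cast hps
  have hp' : (wl S p : ℝ) = t := by exact_mod_cast hp
  have c := cocycle_pt hS hδ g p s (by rw [hp']; linarith)
  have c1 := (abs_le.1 c).1
  have c2 := (abs_le.1 c).2
  have b1 := le_abs_self ((wdist S g s : ℝ) - wl S s)
  have b2 := neg_abs_le ((wdist S g s : ℝ) - wl S s)
  -- step 2
  have k1 := hyp_min hS hδ p 1 s g⁻¹
  have k2 := hyp_min hS hδ p g⁻¹ s (g⁻¹ * s)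
  have k3 : gp S p 1 s = 0 := by
    unfold gp
    rw [wdist_one_left, wdist_comm hS s p, wdist_one_left, hp']
    linarith
  have k4 : (t : ℝ) - wl S g ≤ gp S p 1 g⁻¹ := by
    unfold gp
    rw [wdist_one_left, wdist_one_left, wl_inv hS, hp']
    have : (wl S p : ℝ) ≤ wl S g + wdist S g⁻¹ p := by
      have := wdist_tri hS 1 g⁻¹ p
      rw [wdist_one_left, wdist_one_left, wl_inv hS] at this
      exact_mod_cast this
    rw [hp'] at this
    linarith
  have k5 : (t : ℝ) + 2 * δ + 1 ≤ gp S p (g⁻¹ * s) s := by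
    have := gp_base hS 1 p s (g⁻¹ * s)
    rw [gp_comm hS p, wdist_one_left, hp'] at this
    linarith
  have k6 : gp S p g⁻¹ (g⁻¹ * s) ≤ 2 * δ := by
    rw [k3] at k1
    rcases min_le_iff.1 (sub_nonpos.1 k1) with h1 | h1
    · linarith
    · rcases min_le_iff.1 (show min (gp S p g⁻¹ (g⁻¹ * s)) (gp S p (g⁻¹ * s) s) ≤ 2 * δ by
        linarith) with h2 | h2
      · exact h2
      · linarith
  have k7 : (wl S (g * p) : ℝ) + wdist S (g * p) s - wl S s ≤ 4 * δ := by
    unfold gp at k6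
    have e1 : wdist S g⁻¹ p = wl S (g * p) := by simp [wdist]
    have e2 : wdist S (g⁻¹ * s) p = wdist S (g * p) s := by
      rw [wdist_comm hS, ← wdist_left g]; simp
    have e3 : wdist S g⁻¹ (g⁻¹ * s) = wl S s := by simp [wdist]
    rw [e1, e2, e3] at k6
    linarith
  have f := four_point hδ p (g * p) 1 s
  rw [wdist_one_left, wdist_one_right hS, wdist_one_right hS] at f
  rcases le_max_iff.1 (le_of_eq (rfl : max ((wl S p : ℝ) + wdist S (g * p) s)
    ((wl S (g * p) : ℝ) + wdist S p s) = _)) with h1 | h1 <;> linarith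

/-- Ultrafilter limit of a bounded integer sequence. -/
lemma ultra_int_lim (U : Ultrafilter ℕ) (f : ℕ → ℤ) (N : ℕ) (hf : ∀ n, |f n| ≤ N) :
    ∃ k, ∀ᶠ n in (U : Filter ℕ), f n = k := by
  by_contra hcon
  push Not at hcon
  have h : ∀ k ∈ Finset.Icc (-(N : ℤ)) N, ∀ᶠ n in (U : Filter ℕ), f n ≠ k := by
    intro k _
    have := hcon k
    exact this
  have h2 := (Filter.eventually_all_finset (Finset.Icc (-(N : ℤ)) N)).2 h
  obtain ⟨n, hn⟩ := h2.exists
  have := abs_le.1 (hf n)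
  exact hn (f n) (Finset.mem_Icc.2 this) rfl

/-- The stabilizer of the "boundary point" `lim s`. -/
def stabH {S : Set Γ} {δ : ℝ} (hS : IsGenSet S) (hδ : IsHyperbolic S δ) (U : Ultrafilter ℕ)
    (s : ℕ → Γ) (hs : Tendsto (fun n => (wl S (s n) : ℝ)) U atTop) : Subgroup Γ where
  carrier := {g | Tendsto (fun n => gp S 1 (s n) (g * s n)) U atTop}
  one_mem' := by
    have : (fun n => gp S 1 (s n) (1 * s n)) = fun n => (wl S (s n) : ℝ) := by
      funext n
      simp [gp, wdist_self, wdist_one_right hS]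
    simpa only [Set.mem_ofPred_eq, this] using hs
  mul_mem' := by
    intro g h hg hh
    simp only [Set.mem_ofPred_eq] at *
    have h1 : Tendsto (fun n => min (gp S 1 (s n) (g * s n))
        (gp S 1 (s n) (h * s n) - wl S g) - δ) U atTop := by
      apply tendsto_atTop_add_const_right
      refine tendsto_atTop.2 fun r => ?_
      filter_upwards [tendsto_atTop.1 hg r, tendsto_atTop.1 hh (r + wl S g)] with n a b
      exact le_min a (by linarith)
    refine tendsto_atTop_mono (fun n => ?_) h1
    refine le_trans ?_ (hyp_min hS hδ 1 (s n) (g * h * s n) (g * s n))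
    have h2 := gp_base hS g 1 (g * s n) (g * h * s n)
    have h3 := gp_left (S := S) g 1 (s n) (h * s n)
    rw [mul_one, ← mul_assoc] at h3
    rw [h3, wdist_one_right hS] at h2
    have := min_le_min_left (gp S 1 (s n) (g * s n)) h2
    linarith
  inv_mem' := by
    intro g hg
    simp only [Set.mem_ofPred_eq] at *
    have h1 : Tendsto (fun n => gp S 1 (s n) (g * s n) - wl S g) U atTop :=
      tendsto_atTop_add_const_right _ _ hg
    refine tendsto_atTop_mono (fun n => ?_) h1
    have h2 := gp_base hS 1 g (s n) (g * s n)
    have h3 := gp_left (S := S) g 1 (g⁻¹ * s n) (s n)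
    rw [mul_one, mul_inv_cancel_left] at h3
    rw [h3, gp_comm hS 1 (g⁻¹ * s n), wdist_one_left] at h2
    exact h2

lemma mem_stabH {S : Set Γ} {δ : ℝ} {hS : IsGenSet S} {hδ : IsHyperbolic S δ} {U : Ultrafilter ℕ}
    {s : ℕ → Γ} {hs : Tendsto (fun n => (wl S (s n) : ℝ)) U atTop} {g : Γ} :
    g ∈ stabH hS hδ U s hs ↔ Tendsto (fun n => gp S 1 (s n) (g * s n)) U atTop := Iff.rfl

lemma stabH_elementary {S : Set Γ} {δ : ℝ} (hS : IsGenSet S) (hδ : IsHyperbolic S δ)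
    (U : Ultrafilter ℕ) (s : ℕ → Γ) (hs : Tendsto (fun n => (wl S (s n) : ℝ)) U atTop) :
    ∃ h ∈ stabH hS hδ U s hs, ∃ B : Set Γ, B.Finite ∧
      ∀ g ∈ stabH hS hδ U s hs, ∃ k : ℤ, h ^ k * g ∈ B := by
  have hδ0 := hδ.1
  set H := stabH hS hδ U s hs with hH
  have hb : ∀ g : Γ, ∃ k : ℤ, ∀ᶠ n in (U : Filter ℕ),
      (wdist S g (s n) : ℤ) - wl S (s n) = k := by
    intro g
    refine ultra_int_lim U _ (wl S g) fun n => ?_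
    have h1 := wdist_tri hS 1 g (s n)
    have h2 := wdist_tri hS g 1 (s n)
    rw [wdist_one_left, wdist_one_left] at h1
    rw [wdist_one_left, wdist_one_right hS] at h2
    rw [abs_le]
    constructor <;> omega
  choose β hβ using hb
  have hβr : ∀ g : Γ, ∀ᶠ n in (U : Filter ℕ),
      (wdist S g (s n) : ℝ) - wl S (s n) = β g := by
    intro g
    filter_upwards [hβ g] with n hn
    exact_mod_cast hn
  have hco : ∀ g ∈ H, ∀ g' : Γ, |(β (g * g') : ℝ) - β g - β g'| ≤ 2 * δ := by
    intro g hg g'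
    have hg1 : Tendsto (fun n => gp S 1 (s n) (g⁻¹ * s n)) U atTop := H.inv_mem hg
    obtain ⟨n, h1, h2, h3, h4⟩ := ((hβr (g * g')).and ((hβr g).and ((hβr g').and
      (tendsto_atTop.1 hg1 (wl S g'))))).exists
    have := cocycle_pt hS hδ g g' (s n) h4
    rwa [h1, h2, h3] at this
  have hone : β 1 = 0 := by
    obtain ⟨n, hn⟩ := (hβ 1).exists
    rw [wdist_one_left] at hn
    omega
  -- bounded fibres
  have hfin : ∀ T : ℕ, {g | g ∈ H ∧ |(β g : ℝ)| ≤ T}.Finite := by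
    intro T
    obtain ⟨M, hM⟩ := exists_nat_ge (T + 8 * δ)
    by_contra hinf
    have hBf := ball_finite hS M
    obtain ⟨F, hFs, hFc⟩ := Set.Infinite.exists_subset_card_eq hinf (hBf.toFinset.card + 1)
    obtain ⟨t, ht⟩ := exists_nat_gt ((∑ g ∈ F, (wl S g : ℝ)) + 2 * δ)
    have e1 : ∀ᶠ n in (U : Filter ℕ), ∀ g ∈ F, (wdist S g (s n) : ℝ) - wl S (s n) = β g ∧
        2 * (t : ℝ) + 2 * δ + 1 ≤ gp S 1 (s n) (g⁻¹ * s n) := by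
      refine (Filter.eventually_all_finset F).2 fun g hg => ?_
      have hg1 : Tendsto (fun n => gp S 1 (s n) (g⁻¹ * s n)) U atTop := H.inv_mem (hFs hg).1
      exact (hβr g).and (tendsto_atTop.1 hg1 _)
    obtain ⟨n, hn1, hn2⟩ := (e1.and (tendsto_atTop.1 hs t)).exists
    obtain ⟨p, hp1, hp2⟩ := exists_between hS (s n) t (by exact_mod_cast hn2)
    have hmap : ∀ g ∈ F, p⁻¹ * g * p ∈ hBf.toFinset := by
      intro g hg
      have hsum : (wl S g : ℝ) ≤ ∑ g ∈ F, (wl S g : ℝ) :=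
        Finset.single_le_sum (f := fun g => (wl S g : ℝ)) (fun _ _ => Nat.cast_nonneg _) hg
      have := close_pt hS hδ g p (s n) t hp1 hp2 (by linarith) (hn1 g hg).2
      rw [(hn1 g hg).1] at this
      have h3 := (hFs hg).2
      have h4 : (wdist S p (g * p) : ℝ) ≤ M := by linarith
      simp only [Set.Finite.mem_toFinset, Set.mem_ofPred_eq]
      have h5 : wdist S p (g * p) ≤ M := by exact_mod_cast h4
      unfold wdist at h5
      rwa [← mul_assoc] at h5
    have := Finset.card_le_card_of_injOn (fun g => p⁻¹ * g * p) hmap (by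
      intro a _ b _ hab
      simpa using hab)
    omega
  obtain ⟨T0, hT0⟩ := exists_nat_ge (4 * δ)
  by_cases hcase : ∃ h ∈ H, (T0 : ℝ) < |(β h : ℝ)|
  · obtain ⟨h, hh, hhb⟩ := hcase
    obtain ⟨T1, hT1⟩ := exists_nat_ge (|(β h : ℝ)| + 4 * δ)
    refine ⟨h, hh, _, hfin T1, fun g hg => ?_⟩
    -- minimise
    obtain ⟨k, hk⟩ : ∃ k : ℤ, ∀ j : ℤ, (β (h ^ k * g)).natAbs ≤ (β (h ^ j * g)).natAbs := by
      exact ⟨_, fun j => Function.argmin_le (fun j : ℤ => (β (h ^ j * g)).natAbs) j⟩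
    refine ⟨k, H.mul_mem (H.zpow_mem hh k) hg, ?_⟩
    by_contra hbig
    push Not at hbig
    set x := h ^ k * g with hx
    have m1 : |(β x : ℝ)| ≤ |(β (h * x) : ℝ)| := by
      have := hk (1 + k)
      rw [zpow_add, zpow_one, mul_assoc, ← hx] at this
      rw [← Int.cast_abs, ← Int.cast_abs]
      exact_mod_cast Int.natAbs_le_iff_sq_le.1 this |> sq_le_sq.1
    have m2 : |(β x : ℝ)| ≤ |(β (h⁻¹ * x) : ℝ)| := by
      have := hk (-1 + k)
      rw [zpow_add, zpow_neg_one, mul_assoc, ← hx] at this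
      rw [← Int.cast_abs, ← Int.cast_abs]
      exact_mod_cast Int.natAbs_le_iff_sq_le.1 this |> sq_le_sq.1
    have c1 := abs_le.1 (hco h hh x)
    have c2 := abs_le.1 (hco h⁻¹ (H.inv_mem hh) x)
    have c3 := abs_le.1 (hco h hh h⁻¹)
    rw [mul_inv_cancel, hone, Int.cast_zero] at c3
    obtain ⟨c1a, c1b⟩ := c1
    obtain ⟨c2a, c2b⟩ := c2
    obtain ⟨c3a, c3b⟩ := c3
    rcases abs_cases (β x : ℝ) with ⟨a1, a2⟩ | ⟨a1, a2⟩ <;>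
    rcases abs_cases (β h : ℝ) with ⟨b1, b2⟩ | ⟨b1, b2⟩ <;>
    rcases abs_cases (β (h * x) : ℝ) with ⟨d1, d2⟩ | ⟨d1, d2⟩ <;>
    rcases abs_cases (β (h⁻¹ * x) : ℝ) with ⟨e1, e2⟩ | ⟨e1, e2⟩ <;> linarith
  · push Not at hcase
    refine ⟨1, H.one_mem, _, hfin T0, fun g hg => ⟨0, ?_⟩⟩
    simpa using ⟨hg, hcase g hg⟩


/-! ### Nonamenability -/

lemma index_ne_zero_of_cover (H : Subgroup Γ) (hH : H.index ≠ 0) (h : Γ) (B : Set Γ)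
    (hB : B.Finite) (hc : ∀ g ∈ H, ∃ k : ℤ, h ^ k * g ∈ B) :
    (Subgroup.zpowers h).index ≠ 0 := by
  haveI : H.FiniteIndex := ⟨hH⟩
  haveI : Finite (Γ ⧸ H) := Subgroup.finite_quotient_of_finiteIndex
  haveI : Finite B := hB
  have hs : Function.Surjective (fun p : (Γ ⧸ H) × B =>
      ((p.1.out * (p.2 : Γ)⁻¹ : Γ) : Γ ⧸ Subgroup.zpowers h)) := by
    intro q
    obtain ⟨g, rfl⟩ := QuotientGroup.mk_surjective q
    have h1 : ((g : Γ ⧸ H).out)⁻¹ * g ∈ H := by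
      rw [← QuotientGroup.eq]; simp
    obtain ⟨k, hk⟩ := hc _ (H.inv_mem h1)
    refine ⟨⟨(g : Γ ⧸ H), ⟨_, hk⟩⟩, ?_⟩
    simp only
    rw [QuotientGroup.eq]
    refine Subgroup.mem_zpowers_iff.2 ⟨k, ?_⟩
    group
  haveI := Finite.of_surjective _ hs
  exact Subgroup.index_ne_zero_of_finite

lemma exists_long {S : Set Γ} (hS : IsGenSet S) (hne : Nonelementary Γ) (n : ℕ) :
    ∃ g : Γ, n ≤ wl S g := by
  by_contra hcon
  push Not at hcon
  have : Finite Γ := by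
    rw [← Set.finite_univ_iff]
    exact (ball_finite hS n).subset fun g _ => (hcon g).le
  exact (Subgroup.index_ne_zero_of_finite (H := Subgroup.zpowers (1 : Γ))) (hne 1)

/-- An almost invariant finitely additive probability on a nonelementary hyperbolic group
cannot exist. -/
lemma no_almost_invariant {S : Set Γ} {δ : ℝ} (hS : IsGenSet S) (hδ : IsHyperbolic S δ)
    (hne : Nonelementary Γ)
    (hM : ∀ E : Set Γ, E.Finite → ∃ M : Set Γ → ℝ, (∀ A, 0 ≤ M A) ∧ M Set.univ = 1 ∧
      (∀ A B, Disjoint A B → M (A ∪ B) = M A + M B) ∧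
      ∀ g ∈ E, ∀ A, M A - 1 / 20 ≤ M {x | g⁻¹ * x ∈ A}) : False := by
  choose γ hγ using exists_long hS hne
  have hE : ∀ n : ℕ, ({g : Γ | wl S g ≤ n} ∪ {γ n}).Finite := fun n =>
    (ball_finite hS n).union (Set.finite_singleton _)
  choose M hM0 hM1 hMadd hMinv using fun n => hM _ (hE n)
  have hmono : ∀ n A B, A ⊆ B → M n A ≤ M n B := by
    intro n A B hAB
    have := hMadd n A (B \ A) Set.disjoint_sdiff_right
    rw [Set.union_diff_cancel hAB] at this
    linarith [hM0 n (B \ A)]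
  -- the half spaces
  let V : Γ → Set Γ := fun s => {h | (wl S s : ℝ) / 2 ≤ gp S 1 h s}
  have hex : ∀ n, ∃ s : Γ, n ≤ wl S s ∧ 0.475 ≤ M n (V s) := by
    intro n
    have h1 := hMinv n (γ n) (Or.inr rfl) (V (γ n)⁻¹)ᶜ
    have h2 : {x | (γ n)⁻¹ * x ∈ (V (γ n)⁻¹)ᶜ} ⊆ V (γ n) := by
      intro x hx
      have hx' : ¬ ((wl S (γ n)⁻¹ : ℝ) / 2 ≤ gp S 1 ((γ n)⁻¹ * x) (γ n)⁻¹) := hx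
      show (wl S (γ n) : ℝ) / 2 ≤ gp S 1 x (γ n)
      rw [wl_inv hS] at hx'
      unfold gp at hx' ⊢
      have e1 : wdist S ((γ n)⁻¹ * x) (γ n)⁻¹ = wl S x := by
        rw [← wdist_left (γ n)]; simp [wdist_one_right hS]
      have e2 : wdist S ((γ n)⁻¹ * x) 1 = wdist S x (γ n) := by
        rw [← wdist_left (γ n)]; simp
      rw [e1, e2, wdist_one_right hS, wl_inv hS] at hx'
      rw [wdist_one_right hS, wdist_one_right hS]
      push Not at hx'
      linarith
    have h3 := hmono n _ _ h2
    have h4 := hMadd n (V (γ n)⁻¹) (V (γ n)⁻¹)ᶜ disjoint_compl_right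
    rw [Set.union_compl_self, hM1] at h4
    by_cases hc : 0.475 ≤ M n (V (γ n))
    · exact ⟨γ n, hγ n, hc⟩
    · refine ⟨(γ n)⁻¹, by rw [wl_inv hS]; exact hγ n, ?_⟩
      norm_num at hc ⊢
      linarith
  choose s hs1 hs2 using hex
  let U : Ultrafilter ℕ := hyperfilter ℕ
  have hU : (U : Filter ℕ) ≤ atTop := by
    rw [← Nat.cofinite_eq_atTop]; exact hyperfilter_le_cofinite
  have hs : Tendsto (fun n => (wl S (s n) : ℝ)) U atTop :=
    (tendsto_atTop_mono (fun n => by exact_mod_cast hs1 n) tendsto_natCast_atTop_atTop).mono_left hU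
  have hidx : (stabH hS hδ U s hs).index ≠ 0 := by
    classical
    intro h0
    haveI : Infinite (Γ ⧸ stabH hS hδ U s hs) := by
      by_contra hfin
      rw [not_infinite_iff_finite] at hfin
      exact Subgroup.index_ne_zero_of_finite h0
    obtain ⟨F, hF⟩ := Infinite.exists_subset_card_eq (Γ ⧸ stabH hS hδ U s hs) 3
    obtain ⟨a, b, c, hab, hac, hbc, -⟩ := Finset.card_eq_three.1 hF
    have key : ∀ p q : Γ ⧸ stabH hS hδ U s hs, p ≠ q →
        ∀ᶠ n in (U : Filter ℕ), Disjoint {x | p.out⁻¹ * x ∈ V (s n)} {x | q.out⁻¹ * x ∈ V (s n)} := by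
      intro p q hpq
      have h1 : p.out⁻¹ * q.out ∉ stabH hS hδ U s hs := by
        rw [← QuotientGroup.eq]; simpa using hpq
      rw [mem_stabH, tendsto_atTop] at h1
      push Not at h1
      obtain ⟨r, hr⟩ := h1
      have hr' : ∀ᶠ n in (U : Filter ℕ), gp S 1 (s n) (p.out⁻¹ * q.out * s n) < r := by
        simpa [Ultrafilter.frequently_iff_eventually] using hr
      filter_upwards [hr', tendsto_atTop.1 hs (2 * (r + 2 * wl S p.out + wl S q.out + δ))] with n h2 h3
      rw [Set.disjoint_left]
      intro x hx1 hx2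
      have hx1' : (wl S (s n) : ℝ) / 2 ≤ gp S 1 (p.out⁻¹ * x) (s n) := hx1
      have hx2' : (wl S (s n) : ℝ) / 2 ≤ gp S 1 (q.out⁻¹ * x) (s n) := hx2
      rw [← gp_left p.out, mul_one, mul_inv_cancel_left] at hx1'
      rw [← gp_left q.out, mul_one, mul_inv_cancel_left] at hx2'
      rw [← gp_left p.out, mul_one, mul_assoc, mul_inv_cancel_left] at h2
      have k1 := gp_base hS p.out 1 x (p.out * s n)
      have k2 := gp_base hS q.out 1 x (q.out * s n)
      have k3 := gp_base hS 1 p.out (p.out * s n) (q.out * s n)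
      have k4 := hyp_min hS hδ 1 (p.out * s n) (q.out * s n) x
      rw [gp_comm hS 1 _ x] at k4
      rw [wdist_one_right hS] at k1 k2
      rw [wdist_one_left] at k3
      have n1 : (0 : ℝ) ≤ wl S p.out := Nat.cast_nonneg _
      have n2 : (0 : ℝ) ≤ wl S q.out := Nat.cast_nonneg _
      have k5 : r + wl S p.out + δ ≤ min (gp S 1 x (p.out * s n)) (gp S 1 x (q.out * s n)) :=
        le_min (by linarith) (by linarith)
      linarith
    have hbig : ∀ p : Γ ⧸ stabH hS hδ U s hs, ∀ᶠ n in (U : Filter ℕ),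
        0.425 ≤ M n {x | p.out⁻¹ * x ∈ V (s n)} := by
      intro p
      have : ∀ᶠ n in (U : Filter ℕ), wl S p.out ≤ n := hU (eventually_ge_atTop _)
      filter_upwards [this] with n hn
      have h1 := hMinv n p.out (Or.inl hn) (V (s n))
      have h2 := hs2 n
      norm_num at h1 h2 ⊢
      linarith
    obtain ⟨n, h1, h2, h3, h4, h5, h6⟩ := ((key a b hab).and ((key a c hac).and ((key b c hbc).and
      ((hbig a).and ((hbig b).and (hbig c)))))).exists
    have e1 := hMadd n _ _ h1
    have e2 := hMadd n _ _ (Set.disjoint_union_left.2 ⟨h2, h3⟩)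
    have e3 := hmono n _ Set.univ (Set.subset_univ
      (({x | a.out⁻¹ * x ∈ V (s n)} ∪ {x | b.out⁻¹ * x ∈ V (s n)}) ∪ {x | c.out⁻¹ * x ∈ V (s n)}))
    rw [hM1] at e3
    norm_num at h4 h5 h6
    linarith
  obtain ⟨h, _, B, hB, hcov⟩ := stabH_elementary hS hδ U s hs
  exact index_ne_zero_of_cover _ hidx h B hB hcov (hne h)



/-- Squared `ℓ²` norm of a real function on `Γ`. -/
noncomputable def nsq (φ : Γ → ℝ) : ℝ := ∑' x, φ x ^ 2

/-- Square summability. -/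
def SqS (φ : Γ → ℝ) : Prop := Summable fun x => φ x ^ 2

lemma SqS.shift {φ : Γ → ℝ} (h : SqS φ) (g : Γ) : SqS fun x => φ (g * x) :=
  (Equiv.mulLeft g).summable_iff.2 h

lemma nsq_shift (φ : Γ → ℝ) (g : Γ) : nsq (fun x => φ (g * x)) = nsq φ :=
  (Equiv.mulLeft g).tsum_eq fun x => φ x ^ 2

lemma SqS.add {φ ψ : Γ → ℝ} (h : SqS φ) (h' : SqS ψ) : SqS fun x => φ x + ψ x := by
  refine Summable.of_nonneg_of_le (fun x => sq_nonneg _) (fun x => ?_)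
    ((Summable.mul_left 2 h).add (Summable.mul_left 2 h'))
  nlinarith [sq_nonneg (φ x - ψ x)]

lemma SqS.smul {φ : Γ → ℝ} (h : SqS φ) (c : ℝ) : SqS fun x => c * φ x := by
  unfold SqS
  simp only [mul_pow]
  exact Summable.mul_left _ h

lemma SqS.sub {φ ψ : Γ → ℝ} (h : SqS φ) (h' : SqS ψ) : SqS fun x => φ x - ψ x := by
  have := h.add (h'.smul (-1))
  simpa [sub_eq_add_neg] using this

lemma SqS.sum {ι : Type} (F : Finset ι) {φ : ι → Γ → ℝ} (h : ∀ i ∈ F, SqS (φ i)) :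
    SqS fun x => ∑ i ∈ F, φ i x := by
  classical
  induction F using Finset.induction_on with
  | empty => simp [SqS, summable_zero]
  | insert a F ha ih =>
    simp only [Finset.sum_insert ha]
    exact (h a (Finset.mem_insert_self _ _)).add
      (ih fun i hi => h i (Finset.mem_insert_of_mem hi))

lemma nsq_nonneg (φ : Γ → ℝ) : 0 ≤ nsq φ := tsum_nonneg fun _ => sq_nonneg _

lemma nsq_add_le {φ ψ : Γ → ℝ} (h : SqS φ) (h' : SqS ψ) :
    nsq (fun x => φ x + ψ x) ≤ 2 * nsq φ + 2 * nsq ψ := by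
  unfold nsq
  rw [← tsum_mul_left, ← tsum_mul_left,
    ← (Summable.mul_left 2 h).tsum_add (Summable.mul_left 2 h')]
  refine Summable.tsum_le_tsum (fun x => ?_) (h.add h')
    ((Summable.mul_left 2 h).add (Summable.mul_left 2 h'))
  nlinarith [sq_nonneg (φ x - ψ x)]

/-- No almost invariant vectors. -/
lemma exists_gap {S : Set Γ} {δ : ℝ} (hS : IsGenSet S) (hδ : IsHyperbolic S δ)
    (hne : Nonelementary Γ) :
    ∃ E : Set Γ, E.Finite ∧ ∀ φ : Γ → ℝ, SqS φ → 0 < nsq φ →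
      ∃ g ∈ E, nsq φ ≤ 1600 * nsq (fun x => φ (g * x) - φ x) := by
  classical
  by_contra hcon
  push Not at hcon
  refine no_almost_invariant hS hδ hne fun E hE => ?_
  obtain ⟨φ, hφ, hpos, hall⟩ := hcon E hE
  have hsum : ∀ A : Set Γ, Summable (A.indicator fun x => φ x ^ 2) := fun A => hφ.indicator A
  refine ⟨fun A => (∑' x, A.indicator (fun x => φ x ^ 2) x) / nsq φ, fun A => ?_, ?_, ?_, ?_⟩
  · exact div_nonneg (tsum_nonneg fun x => Set.indicator_nonneg (fun _ _ => sq_nonneg _) _) hpos.le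
  · simp only [Set.indicator_univ]
    exact div_self hpos.ne'
  · intro A B hAB
    show (∑' x, (A ∪ B).indicator (fun x => φ x ^ 2) x) / nsq φ =
      (∑' x, A.indicator (fun x => φ x ^ 2) x) / nsq φ +
        (∑' x, B.indicator (fun x => φ x ^ 2) x) / nsq φ
    rw [← add_div, ← (hsum A).tsum_add (hsum B)]
    congr 1
    refine tsum_congr fun x => ?_
    rw [Set.indicator_union_of_disjoint hAB]
  · intro g hg A
    have h1 : ∑' x, ({x | g⁻¹ * x ∈ A}).indicator (fun x => φ x ^ 2) x
        = ∑' x, A.indicator (fun x => φ (g * x) ^ 2) x := by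
      rw [← (Equiv.mulLeft g).tsum_eq]
      refine tsum_congr fun x => ?_
      by_cases hx : x ∈ A <;> simp [Set.indicator, hx]
    show (∑' x, A.indicator (fun x => φ x ^ 2) x) / nsq φ - 1 / 20 ≤
      (∑' x, ({x | g⁻¹ * x ∈ A}).indicator (fun x => φ x ^ 2) x) / nsq φ
    rw [h1]
    have hφg := hφ.shift g
    have hd := hφg.sub hφ
    have h2 : ∑' x, A.indicator (fun x => φ x ^ 2) x
        ≤ ∑' x, (A.indicator (fun x => φ (g * x) ^ 2) x +
          (40 * (φ (g * x) - φ x) ^ 2 + ((1/80) * φ (g * x) ^ 2 + (1/80) * φ x ^ 2))) := by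
      refine Summable.tsum_le_tsum (fun x => ?_) (hsum A)
        ((Summable.indicator hφg A).add ((Summable.mul_left 40 hd).add
          ((Summable.mul_left (1/80) hφg).add (Summable.mul_left (1/80) hφ))))
      by_cases hx : x ∈ A
      · simp only [Set.indicator_of_mem hx]
        nlinarith [sq_nonneg (80 * (φ x - φ (g * x)) - (φ x + φ (g * x))),
          sq_nonneg (φ x - φ (g * x))]
      · simp only [Set.indicator_of_notMem hx]
        positivity
    rw [Summable.tsum_add (Summable.indicator hφg A) ((Summable.mul_left 40 hd).add
          ((Summable.mul_left (1/80) hφg).add (Summable.mul_left (1/80) hφ))),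
      Summable.tsum_add (Summable.mul_left 40 hd)
          ((Summable.mul_left (1/80) hφg).add (Summable.mul_left (1/80) hφ)),
      Summable.tsum_add (Summable.mul_left (1/80) hφg) (Summable.mul_left (1/80) hφ),
      tsum_mul_left, tsum_mul_left, tsum_mul_left] at h2
    have h3 : ∑' x, φ (g * x) ^ 2 = nsq φ := nsq_shift φ g
    have h4 : ∑' x, φ x ^ 2 = nsq φ := rfl
    have h5 : ∑' x, (φ (g * x) - φ x) ^ 2 = nsq (fun x => φ (g * x) - φ x) := rfl
    rw [h3, h4, h5] at h2
    have h6 := hall g hg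
    rw [sub_le_iff_le_add, div_le_iff₀ hpos, add_mul, div_mul_cancel₀ _ hpos.ne']
    linarith

/-- The Markov operator `φ ↦ Σ_s μ(s) φ(s ·)`. -/
noncomputable def Pop (F : Finset Γ) (μ : Γ → ℝ) : Module.End ℝ (Γ → ℝ) where
  toFun φ := fun x => ∑ s ∈ F, μ s * φ (s * x)
  map_add' φ ψ := by ext x; simp [mul_add, Finset.sum_add_distrib]
  map_smul' c φ := by
    ext x; simp [Finset.mul_sum]
    exact Finset.sum_congr rfl fun s _ => by ring

lemma Pop_apply (F : Finset Γ) (μ : Γ → ℝ) (φ : Γ → ℝ) (x : Γ) :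
    Pop F μ φ x = ∑ s ∈ F, μ s * φ (s * x) := rfl

lemma Pop_sqS (F : Finset Γ) (μ : Γ → ℝ) {φ : Γ → ℝ} (h : SqS φ) : SqS (Pop F μ φ) :=
  SqS.sum F (φ := fun s x => μ s * φ (s * x)) fun s _ => (h.shift s).smul (μ s)

/-- The lazy operator. -/
noncomputable def Top (F : Finset Γ) (μ : Γ → ℝ) : Module.End ℝ (Γ → ℝ) :=
  (1 / 2 : ℝ) • (1 + Pop F μ)

lemma Top_apply (F : Finset Γ) (μ : Γ → ℝ) (φ : Γ → ℝ) (x : Γ) :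
    Top F μ φ x = (1 / 2) * (φ x + ∑ s ∈ F, μ s * φ (s * x)) := by
  simp [Top, Pop_apply]
  ring

lemma Top_sqS (F : Finset Γ) (μ : Γ → ℝ) {φ : Γ → ℝ} (h : SqS φ) : SqS (Top F μ φ) := by
  have := (h.add (Pop_sqS F μ h)).smul (1 / 2)
  have e : Top F μ φ = fun x => (1 / 2) * (φ x + Pop F μ φ x) := by
    ext x; rw [Top_apply, Pop_apply]
  rw [e]; exact this

lemma defect_pt (F : Finset Γ) (μ : Γ → ℝ) (h0 : ∀ g, 0 ≤ μ g) (h1 : ∑ s ∈ F, μ s = 1)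
    (φ : Γ → ℝ) {t : Γ} (ht : t ∈ F) (x : Γ) :
    (Top F μ φ x) ^ 2 + μ t / 4 * (φ (t * x) - φ x) ^ 2 ≤
      (1/2) * φ x ^ 2 + (1/2) * ∑ s ∈ F, μ s * φ (s * x) ^ 2 := by
  rw [Top_apply]
  have hJ : (∑ s ∈ F, μ s * φ (s * x)) ^ 2 ≤ ∑ s ∈ F, μ s * φ (s * x) ^ 2 := by
    have := (even_two.convexOn_pow (𝕜 := ℝ)).map_sum_le (t := F) (w := μ)
      (p := fun s => φ (s * x)) (fun i _ => h0 i) h1 (fun _ _ => Set.mem_univ _)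
    simpa [smul_eq_mul] using this
  have hV : μ t * (φ (t * x) - φ x) ^ 2 ≤ ∑ s ∈ F, μ s * (φ (s * x) - φ x) ^ 2 :=
    Finset.single_le_sum (f := fun s => μ s * (φ (s * x) - φ x) ^ 2)
      (fun s _ => mul_nonneg (h0 s) (sq_nonneg _)) ht
  have hE : ∑ s ∈ F, μ s * (φ (s * x) - φ x) ^ 2 = (∑ s ∈ F, μ s * φ (s * x) ^ 2)
      - 2 * φ x * (∑ s ∈ F, μ s * φ (s * x)) + φ x ^ 2 := by
    have : ∀ s ∈ F, μ s * (φ (s * x) - φ x) ^ 2 =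
        μ s * φ (s * x) ^ 2 - 2 * φ x * (μ s * φ (s * x)) + φ x ^ 2 * μ s := fun s _ => by ring
    rw [Finset.sum_congr rfl this, Finset.sum_add_distrib, Finset.sum_sub_distrib,
      ← Finset.mul_sum, ← Finset.mul_sum, h1, mul_one]
  rw [hE] at hV
  nlinarith

lemma defect (F : Finset Γ) (μ : Γ → ℝ) (h0 : ∀ g, 0 ≤ μ g) (h1 : ∑ s ∈ F, μ s = 1)
    {φ : Γ → ℝ} (hφ : SqS φ) {t : Γ} (ht : t ∈ F) :
    μ t / 4 * nsq (fun x => φ (t * x) - φ x) ≤ nsq φ - nsq (Top F μ φ) := by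
  have hT := Top_sqS F μ hφ
  have hd := (hφ.shift t).sub hφ
  have hs : ∀ s ∈ F, Summable fun x => μ s * φ (s * x) ^ 2 :=
    fun s _ => Summable.mul_left (μ s) (hφ.shift s)
  have h2 := Summable.tsum_le_tsum (defect_pt F μ h0 h1 φ ht)
    (Summable.add hT (Summable.mul_left (μ t / 4) hd))
    ((Summable.mul_left (1/2) hφ).add (Summable.mul_left (1/2) (summable_sum hs)))
  rw [Summable.tsum_add hT (Summable.mul_left (μ t / 4) hd),
    Summable.tsum_add (Summable.mul_left (1/2) hφ) (Summable.mul_left (1/2) (summable_sum hs)),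
    tsum_mul_left, tsum_mul_left, tsum_mul_left, Summable.tsum_finsetSum hs] at h2
  have h3 : ∑ s ∈ F, ∑' x, μ s * φ (s * x) ^ 2 = nsq φ := by
    have : ∀ s ∈ F, ∑' x, μ s * φ (s * x) ^ 2 = μ s * nsq φ := fun s _ => by
      rw [tsum_mul_left]; congr 1; exact nsq_shift φ s
    rw [Finset.sum_congr rfl this, ← Finset.sum_mul, h1, one_mul]
  rw [h3] at h2
  unfold nsq at *
  linarith

lemma defect_list (F : Finset Γ) (μ : Γ → ℝ) (h0 : ∀ g, 0 ≤ μ g) (h1 : ∑ s ∈ F, μ s = 1)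
    (hF : ∀ g, 0 < μ g → g ∈ F) (l : List Γ) (hl : ∀ s ∈ l, 0 < μ s) :
    ∃ D : ℝ, 0 ≤ D ∧ ∀ φ : Γ → ℝ, SqS φ →
      nsq (fun x => φ (l.prod * x) - φ x) ≤ D * (nsq φ - nsq (Top F μ φ)) := by
  induction l with
  | nil => exact ⟨0, le_rfl, fun φ _ => by simp [nsq]⟩
  | cons s l ih =>
    obtain ⟨D, hD, h⟩ := ih fun t ht => hl t (List.mem_cons_of_mem _ ht)
    have hs : 0 < μ s := hl s (by simp)
    refine ⟨2 * (4 / μ s) + 2 * D, by positivity, fun φ hφ => ?_⟩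
    have e : (fun x => φ ((s :: l).prod * x) - φ x) = fun x =>
        ((fun z => φ (s * z) - φ z) (l.prod * x)) + (φ (l.prod * x) - φ x) := by
      ext x; simp [mul_assoc]
    rw [e]
    refine (nsq_add_le (((hφ.shift s).sub hφ).shift l.prod) ((hφ.shift l.prod).sub hφ)).trans ?_
    rw [nsq_shift (fun z => φ (s * z) - φ z)]
    have k1 := defect F μ h0 h1 hφ (hF s hs)
    have k2 := h φ hφ
    have k3 : nsq (fun x => φ (s * x) - φ x) ≤ 4 / μ s * (nsq φ - nsq (Top F μ φ)) := by
      rw [div_mul_eq_mul_div, le_div_iff₀ hs]; linarith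
    nlinarith

lemma contract {S : Set Γ} {δ : ℝ} (hS : IsGenSet S) (hδ : IsHyperbolic S δ)
    (hne : Nonelementary Γ) {μ : Γ → ℝ} (hμ : IsRWMeasure S μ) (F : Finset Γ)
    (h1 : ∑ s ∈ F, μ s = 1) (hF : ∀ g, 0 < μ g → g ∈ F) :
    ∃ κ : ℝ, 0 < κ ∧ κ < 1 ∧ ∀ φ : Γ → ℝ, SqS φ → nsq (Top F μ φ) ≤ κ * nsq φ := by
  obtain ⟨E, hE, hgap⟩ := exists_gap hS hδ hne
  have hD : ∀ g : Γ, ∃ D : ℝ, 0 ≤ D ∧ ∀ φ : Γ → ℝ, SqS φ →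
      nsq (fun x => φ (g * x) - φ x) ≤ D * (nsq φ - nsq (Top F μ φ)) := by
    intro g
    obtain ⟨l, -, hl, rfl⟩ := hμ.nondeg g
    exact defect_list F μ hμ.nonneg h1 hF l hl
  choose D hD0 hD1 using hD
  have hdef : ∀ φ : Γ → ℝ, SqS φ → 0 ≤ nsq φ - nsq (Top F μ φ) := by
    intro φ hφ
    have hne' : F.Nonempty := by
      by_contra h; rw [Finset.not_nonempty_iff_eq_empty] at h; simp [h] at h1
    obtain ⟨t, ht⟩ := hne'
    refine le_trans ?_ (defect F μ hμ.nonneg h1 hφ ht)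
    exact mul_nonneg (div_nonneg (hμ.nonneg t) (by norm_num)) (nsq_nonneg _)
  let B : ℝ := 2 + 1600 * ∑ g ∈ hE.toFinset, D g
  have hB : 2 ≤ B := by
    have : 0 ≤ ∑ g ∈ hE.toFinset, D g := Finset.sum_nonneg fun g _ => hD0 g
    simp only [B]; linarith
  refine ⟨1 - 1 / B, ?_, ?_, ?_⟩
  · have : 1 / B < 1 := by rw [div_lt_one (by linarith)]; linarith
    linarith
  · have : 0 < 1 / B := by positivity
    linarith
  · intro φ hφ
    have hmain : nsq φ ≤ B * (nsq φ - nsq (Top F μ φ)) := by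
      rcases (nsq_nonneg φ).eq_or_lt with h | h
      · rw [← h]
        have := hdef φ hφ
        rw [← h] at this
        exact mul_nonneg (by linarith) this
      · obtain ⟨g, hg, hgE⟩ := hgap φ hφ h
        have k1 := hD1 g φ hφ
        have k2 : D g ≤ ∑ g ∈ hE.toFinset, D g :=
          Finset.single_le_sum (f := D) (fun g _ => hD0 g) (by simpa using hg)
        have k3 := hdef φ hφ
        simp only [B]
        nlinarith
    have hB0 : 0 < B := by linarith
    have : nsq φ / B ≤ nsq φ - nsq (Top F μ φ) := by
      rw [div_le_iff₀ hB0]; linarith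
    have e : (1 - 1 / B) * nsq φ = nsq φ - nsq φ / B := by ring
    linarith

lemma tsum_conv (F : Finset Γ) (μ : Γ → ℝ) (hF : ∀ g, μ g ≠ 0 → g ∈ F) (f : Γ → ℝ) (y : Γ) :
    ∑' z : Γ, f z * μ (z⁻¹ * y) = ∑ s ∈ F, μ s * f (y * s⁻¹) := by
  rw [← ((Equiv.inv Γ).trans (Equiv.mulLeft y)).tsum_eq]
  rw [tsum_eq_sum (s := F)]
  · refine Finset.sum_congr rfl fun s _ => ?_
    simp [mul_comm]
  · intro s hs
    have : μ s = 0 := by by_contra h; exact hs (hF s h)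
    simp [this]

lemma le_sqrt_nsq {φ : Γ → ℝ} (hφ : SqS φ) (x : Γ) : φ x ^ 2 ≤ nsq φ :=
  Summable.le_tsum (f := fun x => φ x ^ 2) hφ x fun _ _ => sq_nonneg _

lemma Pop_pow_nonneg (F : Finset Γ) (μ : Γ → ℝ) (h0 : ∀ g, 0 ≤ μ g) (n : ℕ) {φ : Γ → ℝ}
    (hφ : ∀ x, 0 ≤ φ x) (x : Γ) : 0 ≤ (Pop F μ ^ n) φ x := by
  induction n generalizing x with
  | zero => simpa using hφ x
  | succ n ih =>
    rw [pow_succ', Module.End.mul_apply, Pop_apply]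
    exact Finset.sum_nonneg fun s _ => mul_nonneg (h0 s) (ih _)

lemma Top_pow_ge (F : Finset Γ) (μ : Γ → ℝ) (h0 : ∀ g, 0 ≤ μ g) (k : ℕ) {φ : Γ → ℝ}
    (hφ : ∀ x, 0 ≤ φ x) (x : Γ) :
    (Nat.centralBinom k : ℝ) * (Pop F μ ^ k) φ x ≤ 4 ^ k * (Top F μ ^ (2 * k)) φ x := by
  have e : (4 : ℝ) ^ k • (Top F μ ^ (2 * k)) = (Pop F μ + 1) ^ (2 * k) := by
    unfold Top
    rw [smul_pow, smul_smul, add_comm]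
    have : (4 : ℝ) ^ k * (1 / 2) ^ (2 * k) = 1 := by
      rw [pow_mul, ← mul_pow]; norm_num
    rw [this, one_smul]
  have e2 : 4 ^ k * (Top F μ ^ (2 * k)) φ x = ((Pop F μ + 1) ^ (2 * k)) φ x := by
    rw [← e]; simp
  rw [e2, (Commute.one_right (Pop F μ)).add_pow]
  have e3 : (∑ m ∈ Finset.range (2 * k + 1), Pop F μ ^ m * 1 ^ (2 * k - m) *
      ((2 * k).choose m : Module.End ℝ (Γ → ℝ))) φ x =
      ∑ m ∈ Finset.range (2 * k + 1), ((2 * k).choose m : ℝ) * (Pop F μ ^ m) φ x := by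
    rw [LinearMap.sum_apply, Finset.sum_apply]
    refine Finset.sum_congr rfl fun m _ => ?_
    rw [one_pow, mul_one, (Nat.cast_commute _ _).symm.eq]
    rw [← nsmul_eq_mul]
    simp
  rw [e3]
  refine Finset.single_le_sum (f := fun m => ((2 * k).choose m : ℝ) * (Pop F μ ^ m) φ x)
    (fun m _ => mul_nonneg (Nat.cast_nonneg _) (Pop_pow_nonneg F μ h0 m hφ x)) (a := k) ?_
  simp; omega

lemma ptrans_eq_Pop (F : Finset Γ) (μ : Γ → ℝ) (hF : ∀ g, μ g ≠ 0 → g ∈ F) (x : Γ) (n : ℕ)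
    (z : Γ) : ptrans μ n x z⁻¹ = (Pop F μ ^ n) (fun w => ptrans μ 0 x w⁻¹) z := by
  induction n generalizing z with
  | zero => simp
  | succ n ih =>
    rw [pow_succ', Module.End.mul_apply, Pop_apply]
    show ∑' w : Γ, ptrans μ n x w * μ (w⁻¹ * z⁻¹) = _
    rw [tsum_conv F μ hF]
    refine Finset.sum_congr rfl fun s _ => ?_
    rw [← ih, mul_inv_rev]

/-- Exponential decay of transition probabilities. -/
lemma spectral_gap {S : Set Γ} {δ : ℝ} (hS : IsGenSet S) (hδ : IsHyperbolic S δ)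
    (hne : Nonelementary Γ) {μ : Γ → ℝ} (hμ : IsRWMeasure S μ) :
    ∃ C lam : ℝ, 0 < C ∧ 0 < lam ∧ lam < 1 ∧ ∀ n x y, ptrans μ n x y ≤ C * lam ^ n := by
  classical
  let F := hS.1.toFinset
  have hF : ∀ g, μ g ≠ 0 → g ∈ F := fun g hg => by simpa [F] using hμ.support_subset g hg
  have h1 : ∑ s ∈ F, μ s = 1 := by
    rw [← hμ.total, tsum_eq_sum (s := F)]
    intro s hs; by_contra h; exact hs (hF s h)
  obtain ⟨κ, hκ0, hκ1, hκ⟩ := contract hS hδ hne hμ F h1 fun g hg => hF g hg.ne'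
  have hit : ∀ (n : ℕ) (φ : Γ → ℝ), SqS φ →
      SqS ((Top F μ ^ n) φ) ∧ nsq ((Top F μ ^ n) φ) ≤ κ ^ n * nsq φ := by
    intro n φ hφ
    induction n with
    | zero => simpa using hφ
    | succ n ih =>
      rw [pow_succ', Module.End.mul_apply]
      refine ⟨Top_sqS F μ ih.1, (hκ _ ih.1).trans ?_⟩
      rw [pow_succ', mul_assoc]
      exact mul_le_mul_of_nonneg_left ih.2 hκ0.le
  have hsq : 0 < √κ := Real.sqrt_pos.2 hκ0
  have hsq1 : √κ < 1 := by rw [Real.sqrt_lt' one_pos]; simpa using hκ1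
  have hsqq : √κ * √κ = κ := Real.mul_self_sqrt hκ0.le
  obtain ⟨C, hC⟩ := (tendsto_self_mul_const_pow_of_lt_one hsq.le hsq1).bddAbove_range
  have hC' : ∀ n : ℕ, (n : ℝ) * √κ ^ n ≤ C := fun n => hC ⟨n, rfl⟩
  have hC0 : 0 ≤ C := by simpa using hC' 0
  refine ⟨2 * C + 1, √κ, by positivity, hsq, hsq1, fun n x y => ?_⟩
  let φ : Γ → ℝ := fun w => ptrans μ 0 x w⁻¹
  have hφe : ∀ w, φ w = if w = x⁻¹ then 1 else 0 := by
    intro w; simp only [φ, ptrans]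
    congr 1
    simp only [eq_iff_iff]
    constructor
    · rintro rfl; simp
    · rintro rfl; simp
  have hφ0 : ∀ w, 0 ≤ φ w := fun w => by rw [hφe]; split_ifs <;> norm_num
  have hφs : SqS φ := by
    refine summable_of_ne_finset_zero (s := {x⁻¹}) fun w hw => ?_
    rw [hφe, if_neg (by simpa using hw)]; norm_num
  have hφn : nsq φ = 1 := by
    unfold nsq
    rw [tsum_eq_single x⁻¹]
    · rw [hφe]; simp
    · intro w hw; rw [hφe, if_neg hw]; norm_num
  have hp : ptrans μ n x y = (Pop F μ ^ n) φ y⁻¹ := by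
    rw [← ptrans_eq_Pop F μ hF x n y⁻¹, inv_inv]
  have hPn := Pop_pow_nonneg F μ hμ.nonneg n hφ0 y⁻¹
  rw [hp]
  set a := (Pop F μ ^ n) φ y⁻¹
  rcases Nat.eq_zero_or_pos n with rfl | hn
  · have : a = φ y⁻¹ := by simp [a]
    rw [this, hφe, pow_zero]
    split_ifs <;> linarith
  · have k1 := Top_pow_ge F μ hμ.nonneg n hφ0 y⁻¹
    obtain ⟨k2, k3⟩ := hit (2 * n) φ hφs
    have k4 := (le_sqrt_nsq k2 y⁻¹).trans k3
    rw [hφn, mul_one] at k4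
    have k5 : (Top F μ ^ (2 * n)) φ y⁻¹ ≤ κ ^ n := by
      refine le_of_sq_le_sq ?_ (by positivity)
      rw [← pow_mul, mul_comm n 2]; exact k4
    have k6 : (4 : ℝ) ^ n ≤ 2 * n * Nat.centralBinom n := by
      exact_mod_cast Nat.four_pow_le_two_mul_self_mul_centralBinom n hn
    have hcb : (0 : ℝ) < Nat.centralBinom n := by exact_mod_cast Nat.centralBinom_pos n
    have k7 : Nat.centralBinom n * a ≤ Nat.centralBinom n * (2 * n * κ ^ n) := by
      refine k1.trans ((mul_le_mul_of_nonneg_left k5 (by positivity)).trans ?_)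
      have := mul_le_mul_of_nonneg_right k6 (pow_nonneg hκ0.le n)
      linarith
    have k8 : a ≤ 2 * n * κ ^ n := le_of_mul_le_mul_left k7 hcb
    have k9 : (2 : ℝ) * n * κ ^ n = 2 * (n * √κ ^ n) * √κ ^ n := by
      nth_rewrite 1 [← hsqq]; rw [mul_pow]; ring
    rw [k9] at k8
    refine k8.trans (mul_le_mul_of_nonneg_right ?_ (by positivity))
    linarith [hC' n]



open Classical in
/-- Restricted transition kernel with values in `ℝ≥0∞`. -/
noncomputable def Kr (m : Γ → ℝ≥0∞) (Δ : Set Γ) : ℕ → Γ → Γ → ℝ≥0∞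
  | 0 => fun x y => if x = y ∧ x ∈ Δ then 1 else 0
  | n + 1 => fun x y => if y ∈ Δ then ∑' z : Γ, Kr m Δ n x z * m (z⁻¹ * y) else 0

/-- Restricted Green kernel with values in `ℝ≥0∞`. -/
noncomputable def Gr (m : Γ → ℝ≥0∞) (Δ : Set Γ) (x y : Γ) : ℝ≥0∞ := ∑' n, Kr m Δ n x y

lemma tsum_convE (F : Finset Γ) (m : Γ → ℝ≥0∞) (hF : ∀ g, m g ≠ 0 → g ∈ F) (f : Γ → ℝ≥0∞)
    (y : Γ) : ∑' z : Γ, f z * m (z⁻¹ * y) = ∑ s ∈ F, m s * f (y * s⁻¹) := by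
  rw [← ((Equiv.inv Γ).trans (Equiv.mulLeft y)).tsum_eq]
  rw [tsum_eq_sum (s := F)]
  · refine Finset.sum_congr rfl fun s _ => ?_
    simp [mul_comm]
  · intro s hs
    have : m s = 0 := by by_contra h; exact hs (hF s h)
    simp [this]

lemma ptransR_nonneg {μ : Γ → ℝ} (h0 : ∀ g, 0 ≤ μ g) (Δ : Set Γ) (n : ℕ) (x y : Γ) :
    0 ≤ ptransR μ Δ n x y := by
  induction n generalizing y with
  | zero => simp only [ptransR]; split_ifs <;> norm_num
  | succ n ih =>
    simp only [ptransR]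
    split_ifs
    · exact tsum_nonneg fun z => mul_nonneg (ih z) (h0 _)
    · exact le_rfl

lemma Kr_eq (F : Finset Γ) {μ : Γ → ℝ} (h0 : ∀ g, 0 ≤ μ g) (hF : ∀ g, μ g ≠ 0 → g ∈ F)
    (Δ : Set Γ) (n : ℕ) (x y : Γ) :
    Kr (fun g => ENNReal.ofReal (μ g)) Δ n x y = ENNReal.ofReal (ptransR μ Δ n x y) := by
  induction n generalizing y with
  | zero => simp only [Kr, ptransR]; split_ifs <;> simp
  | succ n ih =>
    simp only [Kr, ptransR]
    split_ifs
    · rw [tsum_conv F μ hF, tsum_convE F (fun g => ENNReal.ofReal (μ g))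
        (fun g hg => hF g fun h => hg (by simp [h]))]
      rw [ENNReal.ofReal_sum_of_nonneg
        fun s _ => mul_nonneg (h0 s) (ptransR_nonneg h0 Δ n x _)]
      refine Finset.sum_congr rfl fun s _ => ?_
      rw [ENNReal.ofReal_mul (h0 s), ih]
    · simp

lemma ptransR_univ (μ : Γ → ℝ) (n : ℕ) (x y : Γ) :
    ptransR μ Set.univ n x y = ptrans μ n x y := by
  induction n generalizing y with
  | zero => by_cases h : x = y <;> simp [ptransR, ptrans, h]
  | succ n ih => simp [ptransR, ptrans, ih]

lemma Kr_mono (m : Γ → ℝ≥0∞) {Δ Δ' : Set Γ} (h : Δ ⊆ Δ') (n : ℕ) (x y : Γ) :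
    Kr m Δ n x y ≤ Kr m Δ' n x y := by
  induction n generalizing y with
  | zero =>
    simp only [Kr]
    split_ifs with h1 h2
    · exact le_rfl
    · exact absurd ⟨h1.1, h h1.2⟩ h2
    · exact zero_le
    · exact le_rfl
  | succ n ih =>
    simp only [Kr]
    split_ifs with h1 h2
    · exact ENNReal.tsum_le_tsum fun z => mul_le_mul_left (ih z) _
    · exact absurd (h h1) h2
    · exact zero_le
    · exact le_rfl

open Classical in
lemma Kr_left (m : Γ → ℝ≥0∞) (Δ : Set Γ) (n : ℕ) (x y : Γ) :
    Kr m Δ (n + 1) x y = if x ∈ Δ then ∑' w, m (x⁻¹ * w) * Kr m Δ n w y else 0 := by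
  induction n generalizing y with
  | zero =>
    simp only [Kr]
    have e1 : ∑' z, (if x = z ∧ x ∈ Δ then (1 : ℝ≥0∞) else 0) * m (z⁻¹ * y)
        = if x ∈ Δ then m (x⁻¹ * y) else 0 := by
      rw [tsum_eq_single x (fun z hz => by simp [hz.symm])]
      simp
    have e2 : ∑' w, m (x⁻¹ * w) * (if w = y ∧ w ∈ Δ then (1 : ℝ≥0∞) else 0)
        = if y ∈ Δ then m (x⁻¹ * y) else 0 := by
      rw [tsum_eq_single y (fun z hz => by simp [hz])]
      simp
    rw [e1, e2]
    split_ifs <;> rfl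
  | succ n ih =>
    rw [Kr]
    simp only [ih]
    by_cases hx : x ∈ Δ
    · by_cases hy : y ∈ Δ
      · simp only [hx, hy, if_true, Kr]
        simp only [← ENNReal.tsum_mul_right, ← ENNReal.tsum_mul_left]
        rw [ENNReal.tsum_comm]
        simp only [mul_assoc]
      · simp [hx, hy, Kr]
    · simp [hx]

open Classical in
lemma Gr_right (m : Γ → ℝ≥0∞) (Δ : Set Γ) (x z : Γ) :
    Gr m Δ x z = (if x = z ∧ x ∈ Δ then 1 else 0) +
      (if z ∈ Δ then ∑' w, Gr m Δ x w * m (w⁻¹ * z) else 0) := by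
  unfold Gr
  rw [tsum_eq_zero_add' ENNReal.summable]
  congr 1
  by_cases hz : z ∈ Δ
  · simp only [Kr, hz, if_true]
    rw [ENNReal.tsum_comm]
    simp only [ENNReal.tsum_mul_right]
  · simp [Kr, hz]

open Classical in
lemma Gr_left (m : Γ → ℝ≥0∞) (Δ : Set Γ) (x z : Γ) :
    Gr m Δ x z = (if x = z ∧ x ∈ Δ then 1 else 0) +
      (if x ∈ Δ then ∑' w, m (x⁻¹ * w) * Gr m Δ w z else 0) := by
  unfold Gr
  rw [tsum_eq_zero_add' ENNReal.summable]
  congr 1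
  by_cases hz : x ∈ Δ
  · simp only [Kr_left, hz, if_true]
    rw [ENNReal.tsum_comm]
    simp only [ENNReal.tsum_mul_left]
  · simp [Kr_left, hz]

lemma Gr_step_right (m : Γ → ℝ≥0∞) (Δ : Set Γ) (x u s : Γ) (h : u * s ∈ Δ) :
    Gr m Δ x u * m s ≤ Gr m Δ x (u * s) := by
  rw [Gr_right m Δ x (u * s), if_pos h]
  refine le_trans ?_ le_add_self
  have := ENNReal.le_tsum (f := fun w => Gr m Δ x w * m (w⁻¹ * (u * s))) u
  simpa using this

lemma Gr_step_left (m : Γ → ℝ≥0∞) (Δ : Set Γ) (y u s : Γ) (h : u ∈ Δ) :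
    m s * Gr m Δ (u * s) y ≤ Gr m Δ u y := by
  rw [Gr_left m Δ u y, if_pos h]
  refine le_trans ?_ le_add_self
  have := ENNReal.le_tsum (f := fun w => m (u⁻¹ * w) * Gr m Δ w y) (u * s)
  simpa using this

lemma one_le_Gr (m : Γ → ℝ≥0∞) (Δ : Set Γ) (v : Γ) (h : v ∈ Δ) : 1 ≤ Gr m Δ v v := by
  rw [Gr_right]; simp [h]

/-- Excursion kernel: first step anywhere, intermediate points in `O`. -/
noncomputable def Dk (m : Γ → ℝ≥0∞) (O : Set Γ) : ℕ → Γ → Γ → ℝ≥0∞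
  | 0 => fun u z => m (u⁻¹ * z)
  | n + 1 => fun u z => ∑' w, O.indicator (Dk m O n u) w * m (w⁻¹ * z)

lemma Dk_le_Kr (m : Γ → ℝ≥0∞) (O : Set Γ) (n : ℕ) (u z : Γ) :
    Dk m O n u z ≤ Kr m Set.univ (n + 1) u z := by
  induction n generalizing z with
  | zero =>
    simp only [Dk, Kr, Set.mem_univ, if_true, and_true]
    classical
    have := ENNReal.le_tsum (f := fun w => (if u = w then (1 : ℝ≥0∞) else 0) * m (w⁻¹ * z)) u
    simpa using this
  | succ n ih =>
    rw [Dk, Kr]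
    simp only [Set.mem_univ, if_true]
    refine ENNReal.tsum_le_tsum fun w => mul_le_mul_left ?_ _
    exact (Set.indicator_le_self _ _ _).trans (ih w)

/-- A nonzero excursion kernel yields a path. -/
lemma Dk_path (m : Γ → ℝ≥0∞) (O : Set Γ) (n : ℕ) (u z : Γ) (h : Dk m O n u z ≠ 0) :
    ∃ w : ℕ → Γ, w 0 = u ∧ w (n + 1) = z ∧ (∀ j, 1 ≤ j → j ≤ n → w j ∈ O) ∧
      ∀ j ≤ n, m ((w j)⁻¹ * w (j + 1)) ≠ 0 := by
  induction n generalizing z with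
  | zero =>
    refine ⟨fun j => if j = 0 then u else z, by simp, by simp, fun j h1 h2 => by omega, ?_⟩
    intro j hj
    obtain rfl : j = 0 := by omega
    simpa [Dk] using h
  | succ n ih =>
    rw [Dk] at h
    rw [Ne, ENNReal.tsum_eq_zero] at h
    push Not at h
    obtain ⟨p, hp⟩ := h
    have h1 := left_ne_zero_of_mul hp
    have h2 := right_ne_zero_of_mul hp
    have hpO : p ∈ O := by
      by_contra hc; exact h1 (Set.indicator_of_notMem hc _)
    rw [Set.indicator_of_mem hpO] at h1
    obtain ⟨w, w0, w1, w2, w3⟩ := ih p h1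
    refine ⟨fun j => if j = n + 2 then z else w j, by simp [w0], by simp, ?_, ?_⟩
    · intro j hj1 hj2
      have : j ≠ n + 2 := by omega
      simp only [this, if_false]
      rcases Nat.lt_or_ge n j with h | h
      · obtain rfl : j = n + 1 := by omega
        rw [w1]; exact hpO
      · exact w2 j hj1 h
    · intro j hj
      have h4 : j ≠ n + 2 := by omega
      simp only [h4, if_false]
      rcases Nat.lt_or_ge n j with h | h
      · obtain rfl : j = n + 1 := by omega
        simp [w1, h2]
      · have : j + 1 ≠ n + 2 := by omega
        simp only [this, if_false]
        exact w3 j h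

/-- Total excursion kernel. -/
noncomputable def Dt (m : Γ → ℝ≥0∞) (O : Set Γ) (u z : Γ) : ℝ≥0∞ := ∑' n, Dk m O n u z

lemma Dt_eq (m : Γ → ℝ≥0∞) (O : Set Γ) (u z : Γ) :
    Dt m O u z = m (u⁻¹ * z) + ∑' w, O.indicator (Dt m O u) w * m (w⁻¹ * z) := by
  unfold Dt
  rw [tsum_eq_zero_add' ENNReal.summable]
  congr 1
  simp only [Dk]
  rw [ENNReal.tsum_comm]
  refine tsum_congr fun w => ?_
  rw [ENNReal.tsum_mul_right]
  congr 1
  by_cases hw : w ∈ O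
  · simp [Set.indicator_of_mem hw]
  · simp [Set.indicator_of_notMem hw]

/-- Last-exit / first-entrance upper bound. -/
lemma Gr_decomp (m : Γ → ℝ≥0∞) (Δ A B : Set Γ) (x y : Γ) (hx : x ∈ A) (hyA : y ∉ A)
    (hyB : y ∈ B) :
    Gr m Δ x y ≤ ∑' u', B.indicator (fun u' => (∑' u, A.indicator (Gr m Δ x) u *
      Dt m (A ∪ B)ᶜ u u') * Gr m Δ u' y) u' := by
  classical
  set O := (A ∪ B)ᶜ with hO
  let E : Γ → ℝ≥0∞ := fun z => ∑' u, A.indicator (Gr m Δ x) u * Dt m O u z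
  have hE : ∀ z, E z = (∑' u, A.indicator (Gr m Δ x) u * m (u⁻¹ * z)) +
      ∑' w, O.indicator E w * m (w⁻¹ * z) := by
    intro z
    have h1 : ∀ u, A.indicator (Gr m Δ x) u * Dt m O u z =
        A.indicator (Gr m Δ x) u * m (u⁻¹ * z) +
          ∑' w, A.indicator (Gr m Δ x) u * (O.indicator (Dt m O u) w * m (w⁻¹ * z)) := by
      intro u; rw [Dt_eq, mul_add, ENNReal.tsum_mul_left]
    show ∑' u, A.indicator (Gr m Δ x) u * Dt m O u z = _
    simp only [h1]
    rw [ENNReal.tsum_add]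
    congr 1
    rw [ENNReal.tsum_comm]
    refine tsum_congr fun w => ?_
    by_cases hw : w ∈ O
    · simp only [Set.indicator_of_mem hw, E, ← mul_assoc, ENNReal.tsum_mul_right]
    · simp [Set.indicator_of_notMem hw]
  let Ψ : Γ → ℝ≥0∞ := fun z => A.indicator (Gr m Δ x) z + O.indicator E z +
    ∑' u', B.indicator E u' * Gr m Δ u' z
  let g : ℕ → Γ → ℝ≥0∞ := fun n z => ∑ k ∈ Finset.range n, Kr m Δ k x z
  have hgG : ∀ n z, g n z ≤ Gr m Δ x z := fun n z => ENNReal.sum_le_tsum _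
  have hgrec : ∀ n z, z ∉ A → g (n + 1) z ≤
      if z ∈ Δ then ∑' w, g n w * m (w⁻¹ * z) else 0 := by
    intro n z hz
    simp only [g]
    rw [Finset.sum_range_succ']
    have : x ≠ z := fun h => hz (h ▸ hx)
    simp only [Kr, this, false_and, if_false, add_zero]
    split_ifs
    · rw [← Summable.tsum_finsetSum fun _ _ => ENNReal.summable]
      simp only [Finset.sum_mul, le_refl]
    · simp
  have hmain : ∀ n z, g n z ≤ Ψ z := by
    intro n
    induction n with
    | zero => intro z; simp [g]
    | succ n ih =>
      intro z
      by_cases hzA : z ∈ A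
      · refine (hgG _ _).trans ?_
        simp only [Ψ, Set.indicator_of_mem hzA, add_assoc]
        exact le_self_add
      refine (hgrec n z hzA).trans ?_
      by_cases hzΔ : z ∈ Δ
      swap
      · simp [hzΔ]
      rw [if_pos hzΔ]
      have s1 : ∑' w, g n w * m (w⁻¹ * z) ≤ ∑' w, Ψ w * m (w⁻¹ * z) :=
        ENNReal.tsum_le_tsum fun w => mul_le_mul_left (ih w) _
      have s2 : ∑' w, Ψ w * m (w⁻¹ * z) = E z +
          ∑' u', B.indicator E u' * ∑' w, Gr m Δ u' w * m (w⁻¹ * z) := by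
        simp only [Ψ, add_mul, ENNReal.tsum_add]
        rw [← hE z]
        congr 1
        simp only [← ENNReal.tsum_mul_right, ← ENNReal.tsum_mul_left]
        rw [ENNReal.tsum_comm]
        simp only [mul_assoc]
      refine s1.trans (s2.le.trans ?_)
      have s3 : ∀ u', Gr m Δ u' z = (if u' = z then 1 else 0) +
          ∑' w, Gr m Δ u' w * m (w⁻¹ * z) := by
        intro u'
        rw [Gr_right, if_pos hzΔ]
        congr 1
        by_cases h : u' = z
        · subst h; simp [hzΔ]
        · simp [h]
      have s4 : ∑' u', B.indicator E u' * Gr m Δ u' z = B.indicator E z +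
          ∑' u', B.indicator E u' * ∑' w, Gr m Δ u' w * m (w⁻¹ * z) := by
        simp only [s3, mul_add, ENNReal.tsum_add]
        congr 1
        rw [tsum_eq_single z (fun w hw => by simp [hw])]
        simp
      simp only [Ψ, Set.indicator_of_notMem hzA, zero_add]
      rw [s4, ← add_assoc]
      refine add_le_add_left ?_ _
      by_cases hzB : z ∈ B
      · rw [Set.indicator_of_mem hzB]; exact le_add_self
      · have : z ∈ O := by rw [hO]; simp [hzA, hzB]
        rw [Set.indicator_of_mem this]; exact le_self_add
  have hlim : Gr m Δ x y ≤ Ψ y := by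
    rw [Gr, ENNReal.tsum_eq_iSup_nat]
    exact iSup_le fun n => hmain n y
  refine hlim.trans ?_
  have hyO : y ∉ O := by rw [hO]; simp [hyB]
  simp only [Ψ, Set.indicator_of_notMem hyA, Set.indicator_of_notMem hyO, zero_add]
  refine ENNReal.tsum_le_tsum fun u' => ?_
  by_cases hu : u' ∈ B
  · simp [Set.indicator_of_mem hu, E]
  · simp [Set.indicator_of_notMem hu]



lemma four_nat {S : Set Γ} {δ : ℝ} (hδ : IsHyperbolic S δ) {t : ℕ} (ht : 2 * δ < t)
    (x y z w : Γ) :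
    wdist S x y + wdist S z w < wdist S x z + wdist S y w + t ∨
    wdist S x y + wdist S z w < wdist S y z + wdist S x w + t := by
  have h := four_point hδ x y z w
  rcases le_total ((wdist S x z : ℝ) + wdist S y w) ((wdist S y z : ℝ) + wdist S x w) with h1 | h1
  · rw [max_eq_right h1] at h
    right
    have : (wdist S x y : ℝ) + wdist S z w < wdist S y z + wdist S x w + t := by linarith
    exact_mod_cast this
  · rw [max_eq_left h1] at h
    left
    have : (wdist S x y : ℝ) + wdist S z w < wdist S x z + wdist S y w + t := by linarith
    exact_mod_cast this

lemma proj_growth {S : Set Γ} {δ : ℝ} (hS : IsGenSet S) (hδ : IsHyperbolic S δ) {t : ℕ}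
    (ht : 2 * δ < t) {N : ℕ} {α : ℕ → Γ}
    (hα : ∀ m n : ℕ, m ≤ N → n ≤ N → wdist S (α m) (α n) = Nat.dist m n)
    (g : Γ) {p : ℕ} (hp : p ≤ N) (hmin : ∀ j ≤ N, wdist S g (α p) ≤ wdist S g (α j))
    {j : ℕ} (hj : j ≤ N) :
    wdist S g (α p) + Nat.dist j p ≤ wdist S g (α j) + 2 * t := by
  have h0 := hmin j hj
  by_cases hk : Nat.dist j p < t
  · omega
  · have hm : ∃ i ≤ N, Nat.dist i p = t ∧ Nat.dist i j + t = Nat.dist j p := by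
      simp only [Nat.dist] at hk ⊢
      rcases le_total p j with h | h
      · exact ⟨p + t, by omega, by omega, by omega⟩
      · exact ⟨p - t, by omega, by omega, by omega⟩
    obtain ⟨i, hi, h1, h2⟩ := hm
    have h3 := hmin i hi
    have h4 := hα p j hp hj
    have h5 := hα i j hi hj
    have h6 := hα i p hi hp
    rw [Nat.dist_comm] at h4
    rcases four_nat hδ ht g (α i) (α p) (α j) with h | h <;> omega

lemma proj_close {S : Set Γ} {δ : ℝ} (hS : IsGenSet S) (hδ : IsHyperbolic S δ) {t : ℕ}
    (ht : 2 * δ < t) {N : ℕ} {α : ℕ → Γ}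
    (hα : ∀ m n : ℕ, m ≤ N → n ≤ N → wdist S (α m) (α n) = Nat.dist m n)
    (g h : Γ) {p q : ℕ} (hp : p ≤ N) (hq : q ≤ N)
    (hpm : ∀ j ≤ N, wdist S g (α p) ≤ wdist S g (α j))
    (hqm : ∀ j ≤ N, wdist S h (α q) ≤ wdist S h (α j))
    (hd : wdist S g h ≤ wdist S g (α p) + wdist S h (α q)) :
    Nat.dist p q ≤ 5 * t := by
  have h1 := proj_growth hS hδ ht hα g hp hpm hq
  have h2 := proj_growth hS hδ ht hα h hq hqm hp
  have h3 := hα q p hq hp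
  rw [Nat.dist_comm q p] at h1 h3
  have h4 := wdist_comm hS (α q) h
  rcases four_nat hδ ht g (α q) h (α p) with h | h <;> omega

lemma path_dist {S : Set Γ} (hS : IsGenSet S) (w : ℕ → Γ) (n : ℕ)
    (hw : ∀ j ≤ n, wdist S (w j) (w (j + 1)) ≤ 1) (i k : ℕ) (hk : i + k ≤ n + 1) :
    wdist S (w i) (w (i + k)) ≤ k := by
  induction k with
  | zero => simp [wdist_self]
  | succ k ih =>
    have h1 := ih (by omega)
    have h2 := hw (i + k) (by omega)
    have h3 := wdist_tri hS (w i) (w (i + k)) (w (i + (k + 1)))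
    rw [← add_assoc] at h3 ⊢
    omega

/-- Paths avoiding a neighbourhood of a geodesic are long. -/
lemma detour {S : Set Γ} {δ : ℝ} (hS : IsGenSet S) (hδ : IsHyperbolic S δ) {t : ℕ}
    (ht : 2 * δ < t) {N : ℕ} {α : ℕ → Γ}
    (hα : ∀ m n : ℕ, m ≤ N → n ≤ N → wdist S (α m) (α n) = Nat.dist m n)
    (R : ℕ) (w : ℕ → Γ) (n : ℕ)
    (hw : ∀ j ≤ n, wdist S (w j) (w (j + 1)) ≤ 1)
    (hO : ∀ j, 1 ≤ j → j ≤ n → ∀ i ≤ N, R < wdist S (w j) (α i))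
    (a b : ℕ) (ha : a ≤ N) (hb : b ≤ N) (hwa : wdist S (w 0) (α a) ≤ R)
    (hwb : wdist S (w (n + 1)) (α b) ≤ R) :
    R * Nat.dist a b ≤ 5 * t * n + R * (4 * R + 4 + 5 * t) := by
  rcases Nat.eq_zero_or_pos n with rfl | hn
  · have h1 := wdist_tri hS (α a) (w 0) (α b)
    have h2 := wdist_tri hS (w 0) (w 1) (α b)
    have h3 := hw 0 le_rfl
    rw [wdist_comm hS (α a) (w 0), hα a b ha hb] at h1
    rw [zero_add] at h3 hwb
    have : Nat.dist a b ≤ 4 * R + 4 + 5 * t := by omega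
    have := Nat.mul_le_mul_left R this
    omega
  rcases Nat.eq_zero_or_pos R with rfl | hR
  · simp
  have hproj : ∀ g : Γ, ∃ p ≤ N, ∀ j ≤ N, wdist S g (α p) ≤ wdist S g (α j) := by
    intro g
    obtain ⟨p, hp, h⟩ := Finset.exists_min_image (Finset.range (N + 1))
      (fun j => wdist S g (α j)) ⟨0, by simp⟩
    exact ⟨p, by simpa [Nat.lt_succ_iff] using hp, fun j hj => h j (by simp; omega)⟩
  choose π hπ hπm using hproj
  have hstep : ∀ r j, j ≤ R * r → 1 + j ≤ n → Nat.dist (π (w 1)) (π (w (1 + j))) ≤ 5 * t * r := by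
    intro r
    induction r with
    | zero => intro j hj _; obtain rfl : j = 0 := by omega
              simp
    | succ r ih =>
      intro j hj hjn
      by_cases hc : j ≤ R * r
      · have := ih j hc hjn
        have : 5 * t * r ≤ 5 * t * (r + 1) := Nat.mul_le_mul_left _ (by omega)
        omega
      · have h1 := ih (R * r) le_rfl (by omega)
        have h2 := path_dist hS w n hw (1 + R * r) (j - R * r) (by omega)
        rw [show 1 + R * r + (j - R * r) = 1 + j by omega] at h2
        have h3 := hO (1 + R * r) (by omega) (by omega) _ (hπ (w (1 + R * r)))
        have h4 := hO (1 + j) (by omega) (by omega) _ (hπ (w (1 + j)))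
        have h6 : j ≤ R * r + R := by rw [Nat.mul_succ] at hj; exact hj
        have h5 := proj_close hS hδ ht hα _ _ (hπ (w (1 + R * r))) (hπ (w (1 + j)))
          (hπm _) (hπm _) (by omega)
        have h8 := Nat.dist.triangle_inequality (π (w 1)) (π (w (1 + R * r))) (π (w (1 + j)))
        have h9 : 5 * t * (r + 1) = 5 * t * r + 5 * t := by ring
        omega
  have hend : ∀ (z g : Γ) (c : ℕ), c ≤ N → wdist S z (α c) ≤ R → wdist S z g ≤ 1 →
      Nat.dist c (π g) ≤ 2 * R + 2 := by
    intro z g c hc h1 h2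
    have h3 := hπm g c hc
    have h4 := wdist_tri hS g z (α c)
    have h5 := wdist_tri hS (α c) g (α (π g))
    rw [hα _ _ hc (hπ g), wdist_comm hS (α c) g] at h5
    rw [wdist_comm hS g z] at h4
    omega
  have e1 := hend (w 0) (w 1) a ha hwa (hw 0 (by omega))
  have e2 := hend (w (n + 1)) (w n) b hb hwb (by rw [wdist_comm hS]; exact hw n le_rfl)
  have e3 := hstep (n / R + 1) (n - 1) (by
    have := Nat.div_add_mod n R
    have := Nat.mod_lt n hR
    rw [Nat.mul_succ]; omega) (by omega)
  rw [show 1 + (n - 1) = n by omega] at e3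
  have e4 := Nat.dist.triangle_inequality a (π (w 1)) b
  have e5 := Nat.dist.triangle_inequality (π (w 1)) (π (w n)) b
  rw [Nat.dist_comm (π (w n)) b] at e5
  have e6 : Nat.dist a b ≤ 4 * R + 4 + 5 * t * (n / R + 1) := by omega
  have e7 := Nat.mul_le_mul_left R e6
  have e8 : R * (5 * t * (n / R)) ≤ 5 * t * n := by
    have := Nat.mul_le_mul_left (5 * t) (Nat.mul_div_le n R)
    calc R * (5 * t * (n / R)) = 5 * t * (R * (n / R)) := by ring
      _ ≤ _ := this
  have e9 : R * (4 * R + 4 + 5 * t * (n / R + 1)) =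
    R * (5 * t * (n / R)) + R * (4 * R + 4 + 5 * t) := by ring
  omega



lemma harnack_const {S : Set Γ} (hS : IsGenSet S) (m : Γ → ℝ≥0∞)
    (hm : ∀ g, m g ≠ 0 → g ∈ S)
    (hnd : ∀ g : Γ, ∃ l : List Γ, (∀ x ∈ l, m x ≠ 0) ∧ l.prod = g) :
    ∃ (M : ℕ) (q : ℝ≥0∞), q ≠ 0 ∧ q ≤ 1 ∧ ∀ s ∈ S, ∃ l : List Γ, l.prod = s ∧
      (∀ x ∈ l, x ∈ S) ∧ l.length ≤ M ∧ q ≤ (l.map m).prod := by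
  choose l hl hp using hnd
  refine ⟨∑ s ∈ hS.1.toFinset, (l s).length,
    min 1 (hS.1.toFinset.inf fun s => ((l s).map m).prod), ?_, min_le_left _ _, ?_⟩
  · rw [← pos_iff_ne_zero, lt_min_iff]
    refine ⟨one_pos, ?_⟩
    rw [Finset.lt_inf_iff ENNReal.zero_lt_top]
    intro s _
    rw [pos_iff_ne_zero]
    intro h0
    rw [List.prod_eq_zero_iff] at h0
    obtain ⟨x, hx, hx0⟩ := List.mem_map.1 h0
    exact hl s x hx hx0
  · intro s hs
    have hs' : s ∈ hS.1.toFinset := by simpa using hs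
    refine ⟨l s, hp s, fun x hx => hm x (hl s x hx), ?_, ?_⟩
    · exact Finset.single_le_sum (f := fun s => (l s).length) (fun _ _ => Nat.zero_le _) hs'
    · exact (min_le_right _ _).trans (Finset.inf_le hs')

lemma list_right {S : Set Γ} (hS : IsGenSet S) (m : Γ → ℝ≥0∞) (Δ : Set Γ) (x : Γ)
    (l : List Γ) (hl : ∀ s ∈ l, s ∈ S) (u : Γ) (hu : ∀ g, wdist S u g ≤ l.length → g ∈ Δ) :
    Gr m Δ x u * (l.map m).prod ≤ Gr m Δ x (u * l.prod) := by
  induction l generalizing u with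
  | nil => simp
  | cons s l ih =>
    have h1 := wdist_mul_gen u (hl s (by simp))
    have hd : ∀ g, wdist S (u * s) g ≤ l.length → g ∈ Δ := by
      intro g hg
      apply hu
      have := wdist_tri hS u (u * s) g
      simp only [List.length_cons]; omega
    have h2 := ih (fun t ht => hl t (by simp [ht])) (u * s) hd
    have h3 := Gr_step_right m Δ x u s (hd _ (by simp [wdist_self]))
    simp only [List.map_cons, List.prod_cons]
    rw [← mul_assoc, ← mul_assoc]
    exact (mul_le_mul_left h3 _).trans h2

lemma list_left {S : Set Γ} (hS : IsGenSet S) (m : Γ → ℝ≥0∞) (Δ : Set Γ) (y : Γ)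
    (l : List Γ) (hl : ∀ s ∈ l, s ∈ S) (u : Γ) (hu : ∀ g, wdist S u g ≤ l.length → g ∈ Δ) :
    (l.map m).prod * Gr m Δ (u * l.prod) y ≤ Gr m Δ u y := by
  induction l generalizing u with
  | nil => simp
  | cons s l ih =>
    have h1 := wdist_mul_gen u (hl s (by simp))
    have hd : ∀ g, wdist S (u * s) g ≤ l.length → g ∈ Δ := by
      intro g hg
      apply hu
      have := wdist_tri hS u (u * s) g
      simp only [List.length_cons]; omega
    have h2 := ih (fun t ht => hl t (by simp [ht])) (u * s) hd
    have h3 := Gr_step_left m Δ y u s (hu _ (by simp [wdist_self]))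
    simp only [List.map_cons, List.prod_cons]
    rw [mul_assoc, ← mul_assoc u s]
    exact (mul_le_mul_right h2 _).trans h3

/-- One step Harnack inequality for a function on the set `W`. -/
def Hk (S W : Set Γ) (q : ℝ≥0∞) (f : Γ → ℝ≥0∞) : Prop :=
  ∀ g h, g ∈ W → h ∈ W → g⁻¹ * h ∈ S → q * f g ≤ f h

lemma Hk_ball {S W : Set Γ} (hS : IsGenSet S) {q : ℝ≥0∞} (hq : q ≤ 1) {f : Γ → ℝ≥0∞}
    (hf : Hk S W q f) (p : Γ) (k : ℕ) (u : Γ) (hu : wdist S u p ≤ k)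
    (hW : ∀ g, wdist S g p ≤ k → g ∈ W) : q ^ k * f u ≤ f p := by
  induction k generalizing u with
  | zero =>
    have h1 := wl_eq_zero hS (g := u⁻¹ * p) (Nat.le_zero.1 hu)
    have : u = p := by rwa [inv_mul_eq_one] at h1
    simp [this]
  | succ k ih =>
    obtain ⟨l, hl, hlS, hlp⟩ := wl_spec hS (u⁻¹ * p)
    cases l with
    | nil =>
      simp only [List.prod_nil] at hlp
      have : u = p := by rwa [eq_comm, inv_mul_eq_one] at hlp
      rw [this]
      exact mul_le_of_le_one_left' (pow_le_one' hq _)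
    | cons s l =>
      have hs : s ∈ S := hlS s (by simp)
      have h1 : wdist S (u * s) p ≤ k := by
        have e : (u * s)⁻¹ * p = l.prod := by
          rw [List.prod_cons] at hlp
          rw [mul_inv_rev, mul_assoc, ← hlp]; simp
        unfold wdist at hu ⊢
        rw [e]
        have := wl_le_of_list l fun x hx => hlS x (by simp [hx])
        simp only [List.length_cons] at hl
        omega
      have h2 := ih (u * s) h1 fun g hg => hW g (by omega)
      have h3 := hf u (u * s) (hW _ hu) (hW _ (by omega)) (by simpa using hs)
      rw [pow_succ, mul_assoc]
      exact (mul_le_mul_right h3 _).trans h2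

lemma mem_of_wl_one {S : Set Γ} (hS : IsGenSet S) {g : Γ} (h : wl S g = 1) : g ∈ S := by
  obtain ⟨l, hl, hlS, hlp⟩ := wl_spec hS g
  rw [h, List.length_eq_one_iff] at hl
  obtain ⟨s, rfl⟩ := hl
  rw [← hlp]; simpa using hlS s (by simp)

lemma Hk_seg {S W : Set Γ} (hS : IsGenSet S) {q : ℝ≥0∞} {f : Γ → ℝ≥0∞}
    (hf : Hk S W q f) {N : ℕ} {α : ℕ → Γ}
    (hα : ∀ m n : ℕ, m ≤ N → n ≤ N → wdist S (α m) (α n) = Nat.dist m n)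
    (hW : ∀ j ≤ N, α j ∈ W) (i : ℕ) (hi : i ≤ N) (k a : ℕ) (ha : a ≤ N)
    (hk : Nat.dist a i = k) : q ^ k * f (α a) ≤ f (α i) := by
  induction k generalizing a with
  | zero =>
    have : a = i := Nat.eq_of_dist_eq_zero hk
    simp [this]
  | succ k ih =>
    have : ∃ b ≤ N, Nat.dist b i = k ∧ Nat.dist a b = 1 := by
      simp only [Nat.dist] at hk ⊢
      rcases le_total a i with h | h
      · exact ⟨a + 1, by omega, by omega, by omega⟩
      · exact ⟨a - 1, by omega, by omega, by omega⟩
    obtain ⟨b, hb, h1, h2⟩ := this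
    have h3 := hf (α a) (α b) (hW a ha) (hW b hb)
      (mem_of_wl_one hS (by rw [← h2]; exact hα a b ha hb))
    rw [pow_succ, mul_assoc]
    exact (mul_le_mul_right h3 _).trans (ih b hb h1)

lemma Hk_right {S : Set Γ} (hS : IsGenSet S) (m : Γ → ℝ≥0∞) {M : ℕ} {q : ℝ≥0∞}
    (hM : ∀ s ∈ S, ∃ l : List Γ, l.prod = s ∧
      (∀ x ∈ l, x ∈ S) ∧ l.length ≤ M ∧ q ≤ (l.map m).prod) (Δ : Set Γ) (x : Γ) :
    Hk S {g | ∀ h, wdist S g h ≤ M → h ∈ Δ} q (Gr m Δ x) := by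
  intro g h hg _ hs
  obtain ⟨l, h1, h2, h3, h4⟩ := hM _ hs
  have := list_right hS m Δ x l h2 g fun z hz => hg z (hz.trans h3)
  rw [h1, mul_inv_cancel_left] at this
  rw [mul_comm]
  exact (mul_le_mul_right h4 _).trans this

lemma Hk_left {S : Set Γ} (hS : IsGenSet S) (m : Γ → ℝ≥0∞) {M : ℕ} {q : ℝ≥0∞}
    (hM : ∀ s ∈ S, ∃ l : List Γ, l.prod = s ∧
      (∀ x ∈ l, x ∈ S) ∧ l.length ≤ M ∧ q ≤ (l.map m).prod) (Δ : Set Γ) (y : Γ) :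
    Hk S {g | ∀ h, wdist S g h ≤ M → h ∈ Δ} q (fun g => Gr m Δ g y) := by
  intro g h _ hh hs
  have hs' : h⁻¹ * g ∈ S := by simpa using hS.2.1 _ hs
  obtain ⟨l, h1, h2, h3, h4⟩ := hM _ hs'
  have := list_left hS m Δ y l h2 h fun z hz => hh z (hz.trans h3)
  rw [h1, mul_inv_cancel_left] at this
  exact (mul_le_mul_left h4 _).trans this

/-- Decay of the excursion kernel. -/
lemma Dt_bound {S : Set Γ} {δ : ℝ} (hS : IsGenSet S) (hδ : IsHyperbolic S δ) {t : ℕ}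
    (ht : 2 * δ < t) (m : Γ → ℝ≥0∞) (hm : ∀ g, m g ≠ 0 → g ∈ S)
    {Cg ν θ : ℝ≥0∞} (hν0 : ν ≠ 0) (hν1 : ν < 1)
    (hgap : ∀ n x y, Kr m Set.univ n x y ≤ Cg * (ν ^ n * ν ^ n))
    (M' : ℕ) (hM' : ν ^ M' ≤ θ) {N : ℕ} {α : ℕ → Γ}
    (hα : ∀ m n : ℕ, m ≤ N → n ≤ N → wdist S (α m) (α n) = Nat.dist m n) (O : Set Γ)
    (hO : ∀ w ∈ O, ∀ i ≤ N, 5 * t * M' < wdist S w (α i))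
    (u z : Γ) (a b : ℕ) (ha : a ≤ N) (hb : b ≤ N) (hua : wdist S u (α a) ≤ 5 * t * M')
    (hzb : wdist S z (α b) ≤ 5 * t * M') :
    Dt m O u z ≤ Cg * (ν ^ (M' * (4 * (5 * t * M') + 4 + 5 * t)))⁻¹ * (1 - ν)⁻¹ *
      θ ^ Nat.dist a b := by
  set K := M' * (4 * (5 * t * M') + 4 + 5 * t) with hK
  have ht0 : 0 < t := by
    have : (0 : ℝ) < t := by linarith [hδ.1]
    exact_mod_cast this
  have hνt : ν ≠ ⊤ := (hν1.trans ENNReal.one_lt_top).ne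
  have key : ∀ n, Dk m O n u z ≤ Cg * (ν ^ K)⁻¹ * θ ^ Nat.dist a b * ν ^ n := by
    intro n
    by_cases h0 : Dk m O n u z = 0
    · rw [h0]; exact zero_le
    obtain ⟨w, w0, w1, w2, w3⟩ := Dk_path m O n u z h0
    have hd := detour hS hδ ht hα (5 * t * M') w n
      (fun j hj => wl_gen (hm _ (w3 j hj)))
      (fun j h1 h2 => hO _ (w2 j h1 h2)) a b ha hb (by rwa [w0]) (by rwa [w1])
    have hd2 : M' * Nat.dist a b ≤ n + K := by
      have : (5 * t) * (M' * Nat.dist a b) ≤ (5 * t) * (n + K) := by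
        rw [hK]; calc _ = 5 * t * M' * Nat.dist a b := by ring
          _ ≤ _ := hd
          _ = _ := by ring
      exact Nat.le_of_mul_le_mul_left this (by omega)
    have h1 : ν ^ n * ν ^ K ≤ θ ^ Nat.dist a b := by
      rw [← pow_add]
      refine (pow_le_pow_right_of_le_one' hν1.le hd2).trans ?_
      rw [pow_mul]
      exact pow_le_pow_left' hM' _
    have h2 : ν ^ n ≤ (ν ^ K)⁻¹ * θ ^ Nat.dist a b := by
      rw [mul_comm, ← div_eq_mul_inv]
      rw [ENNReal.le_div_iff_mul_le (Or.inl (pow_ne_zero _ hν0)) (Or.inl (ENNReal.pow_ne_top hνt))]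
      exact h1
    refine (Dk_le_Kr m O n u z).trans ((hgap _ _ _).trans ?_)
    have h3 : ν ^ (n + 1) ≤ ν ^ n := pow_le_pow_right_of_le_one' hν1.le (by omega)
    calc Cg * (ν ^ (n + 1) * ν ^ (n + 1)) ≤ Cg * (((ν ^ K)⁻¹ * θ ^ Nat.dist a b) * ν ^ n) := by
          gcongr
          exact h3.trans h2
      _ = _ := by ring
  unfold Dt
  refine (ENNReal.tsum_le_tsum key).trans ?_
  rw [ENNReal.tsum_mul_left, ENNReal.tsum_geometric]
  apply le_of_eq; ring

lemma ball_sum {S : Set Γ} (hS : IsGenSet S) (R : ℕ) :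
    ∃ β : ℝ≥0∞, β ≠ ⊤ ∧ ∀ (A : Set Γ) (p : ℕ → Γ) (k : Γ → ℕ),
      (∀ u ∈ A, wdist S u (p (k u)) ≤ R) →
      ∑' u, A.indicator (fun u => (2⁻¹ : ℝ≥0∞) ^ k u) u ≤ β := by
  classical
  let F := (ball_finite hS R).toFinset
  refine ⟨∑' j : ℕ, (F.card : ℝ≥0∞) * (2⁻¹ : ℝ≥0∞) ^ j, ?_, ?_⟩
  · rw [ENNReal.tsum_mul_left, ENNReal.tsum_geometric]
    refine ENNReal.mul_ne_top (by simp) ?_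
    rw [ENNReal.inv_ne_top]
    simp [ENNReal.one_sub_inv_two]
  · intro A p k h
    calc ∑' u, A.indicator (fun u => (2⁻¹ : ℝ≥0∞) ^ k u) u
        ≤ ∑' u, ∑' j : ℕ, (if wdist S u (p j) ≤ R then (2⁻¹ : ℝ≥0∞) ^ j else 0) := by
          refine ENNReal.tsum_le_tsum fun u => ?_
          by_cases hu : u ∈ A
          · rw [Set.indicator_of_mem hu]
            have := ENNReal.le_tsum
              (f := fun j : ℕ => if wdist S u (p j) ≤ R then (2⁻¹ : ℝ≥0∞) ^ j else 0) (k u)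
            simpa only [h u hu, if_true] using this
          · rw [Set.indicator_of_notMem hu]; exact zero_le
      _ = ∑' j : ℕ, ∑' u, (if wdist S u (p j) ≤ R then (2⁻¹ : ℝ≥0∞) ^ j else 0) :=
          ENNReal.tsum_comm
      _ ≤ _ := by
          refine ENNReal.tsum_le_tsum fun j => ?_
          rw [← (Equiv.mulLeft (p j)).tsum_eq]
          have : ∀ g, (wdist S (p j * g) (p j) ≤ R) ↔ g ∈ F := by
            intro g
            have : wdist S (p j * g) (p j) = wl S g := by
              have := wdist_left (S := S) (p j) g 1
              rw [mul_one] at this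
              rw [this, wdist_one_right hS]
            simp [F, this]
          simp only [Equiv.coe_mulLeft, this]
          rw [tsum_eq_sum (s := F) (fun g hg => by simp [hg])]
          rw [Finset.sum_congr rfl (fun g hg => if_pos hg)]
          simp



/-- Ancona's inequality in `ℝ≥0∞`. -/
lemma ancona {S : Set Γ} {δ : ℝ} (hS : IsGenSet S) (hδ : IsHyperbolic S δ)
    (m : Γ → ℝ≥0∞) (hm : ∀ g, m g ≠ 0 → g ∈ S)
    (hnd : ∀ g : Γ, ∃ l : List Γ, (∀ x ∈ l, m x ≠ 0) ∧ l.prod = g)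
    {Cg ν : ℝ≥0∞} (hCg : Cg ≠ ⊤) (hν0 : ν ≠ 0) (hν1 : ν < 1)
    (hgap : ∀ n x y, Kr m Set.univ n x y ≤ Cg * (ν ^ n * ν ^ n)) :
    ∃ (R0 : ℕ) (C : ℝ≥0∞), C ≠ ⊤ ∧ ∀ (N : ℕ) (α : ℕ → Γ) (Δ : Set Γ) (i : ℕ), i ≤ N →
      (∀ m n : ℕ, m ≤ N → n ≤ N → wdist S (α m) (α n) = Nat.dist m n) →
      (∀ j ≤ N, ∀ g, wdist S g (α j) ≤ R0 → g ∈ Δ) →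
      Gr m Δ (α 0) (α N) ≤ C * (Gr m Δ (α 0) (α i) * Gr m Δ (α i) (α N)) := by
  classical
  obtain ⟨M, q, hq0, hq1, hM⟩ := harnack_const hS m hm hnd
  have hqt : q ≠ ⊤ := (hq1.trans_lt ENNReal.one_lt_top).ne
  obtain ⟨t, ht⟩ := exists_nat_gt (2 * δ)
  obtain ⟨M', hM'⟩ : ∃ M' : ℕ, ν ^ M' ≤ q * 2⁻¹ := by
    have h1 := ENNReal.tendsto_pow_atTop_nhds_zero_of_lt_one hν1
    have h2 : (0 : ℝ≥0∞) < q * 2⁻¹ :=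
      pos_iff_ne_zero.2 (mul_ne_zero hq0 (by simp))
    obtain ⟨n, hn⟩ := (h1.eventually (gt_mem_nhds h2)).exists
    exact ⟨n, hn.le⟩
  set R := 5 * t * M' with hR
  obtain ⟨β, hβ, hsum⟩ := ball_sum hS R
  set C1 := Cg * (ν ^ (M' * (4 * R + 4 + 5 * t)))⁻¹ * (1 - ν)⁻¹ with hC1
  set cR := (q ^ R)⁻¹ with hcR
  have hcRt : cR ≠ ⊤ := ENNReal.inv_ne_top.2 (pow_ne_zero _ hq0)
  have hC1t : C1 ≠ ⊤ := by
    refine ENNReal.mul_ne_top (ENNReal.mul_ne_top hCg (ENNReal.inv_ne_top.2 (pow_ne_zero _ hν0))) ?_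
    rw [ENNReal.inv_ne_top]
    exact (tsub_pos_of_lt hν1).ne'
  refine ⟨R + M, C1 * cR * cR * β * β + cR * cR, ?_, ?_⟩
  · exact ENNReal.add_ne_top.2 ⟨ENNReal.mul_ne_top (ENNReal.mul_ne_top (ENNReal.mul_ne_top
      (ENNReal.mul_ne_top hC1t hcRt) hcRt) hβ) hβ, ENNReal.mul_ne_top hcRt hcRt⟩
  intro N α Δ i hi hα hΔ
  set W : Set Γ := {g | ∀ h, wdist S g h ≤ M → h ∈ Δ} with hW
  have hWb : ∀ j ≤ N, ∀ g, wdist S g (α j) ≤ R → g ∈ W := by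
    intro j hj g hg h hh
    apply hΔ j hj
    have := wdist_tri hS h g (α j)
    rw [wdist_comm hS h g] at this
    omega
  have hWα : ∀ j ≤ N, α j ∈ W := fun j hj => hWb j hj _ (by simp [wdist_self])
  have hcon : ∀ f : Γ → ℝ≥0∞, Hk S W q f → ∀ u a, a ≤ N → wdist S u (α a) ≤ R →
      q ^ Nat.dist a i * f u ≤ cR * f (α i) := by
    intro f hf u a ha hu
    have h1 := Hk_ball hS hq1 hf (α a) R u hu (hWb a ha)
    have h2 := Hk_seg hS hf hα hWα i hi _ a ha rfl
    rw [hcR, mul_comm (q ^ R)⁻¹, ← div_eq_mul_inv,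
      ENNReal.le_div_iff_mul_le (Or.inl (pow_ne_zero _ hq0)) (Or.inl (ENNReal.pow_ne_top hqt))]
    calc q ^ Nat.dist a i * f u * q ^ R = q ^ Nat.dist a i * (q ^ R * f u) := by ring
      _ ≤ q ^ Nat.dist a i * f (α a) := by gcongr
      _ ≤ _ := h2
  have hx := Hk_right hS m hM Δ (α 0)
  have hy := Hk_left hS m hM Δ (α N)
  let A : Set Γ := {u | ∃ k ≤ i, wdist S u (α (i - k)) ≤ R}
  let B : Set Γ := {u | ∃ k, i + k ≤ N ∧ wdist S u (α (i + k)) ≤ R}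
  have hxA : α 0 ∈ A := ⟨i, le_rfl, by simp [wdist_self]⟩
  have hyB : α N ∈ B := ⟨N - i, by omega, by rw [show i + (N - i) = N by omega]; simp [wdist_self]⟩
  by_cases hyA : α N ∈ A
  · obtain ⟨k, hk, hd⟩ := hyA
    have hNi : N - i ≤ R := by
      rw [hα N _ le_rfl (by omega)] at hd
      simp only [Nat.dist] at hd
      omega
    have h1 := hcon _ hx (α N) i hi (by
      rw [hα N i le_rfl hi]; simp only [Nat.dist]; omega)
    rw [Nat.dist_self, pow_zero, one_mul] at h1
    have h2 := hcon _ hy (α N) i hi (by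
      rw [hα N i le_rfl hi]; simp only [Nat.dist]; omega)
    rw [Nat.dist_self, pow_zero, one_mul] at h2
    have h3 := one_le_Gr m Δ (α N) (hΔ N le_rfl _ (by simp [wdist_self]))
    calc Gr m Δ (α 0) (α N) ≤ cR * Gr m Δ (α 0) (α i) := h1
      _ = cR * Gr m Δ (α 0) (α i) * 1 := by rw [mul_one]
      _ ≤ cR * Gr m Δ (α 0) (α i) * (cR * Gr m Δ (α i) (α N)) := by
          gcongr
          exact h3.trans h2
      _ = cR * cR * (Gr m Δ (α 0) (α i) * Gr m Δ (α i) (α N)) := by ring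
      _ ≤ _ := by gcongr; exact le_add_self
  have hdec := Gr_decomp m Δ A B (α 0) (α N) hxA hyA hyB
  set O := (A ∪ B)ᶜ with hO
  have hOw : ∀ w ∈ O, ∀ j ≤ N, R < wdist S w (α j) := by
    intro w hw j hj
    by_contra hc
    push Not at hc
    apply hw
    rcases le_total j i with h | h
    · exact Or.inl ⟨i - j, by omega, by rwa [show i - (i - j) = j by omega]⟩
    · exact Or.inr ⟨j - i, by omega, by rwa [show i + (j - i) = j by omega]⟩
  have hkA : ∀ u, ∃ k, u ∈ A → k ≤ i ∧ wdist S u (α (i - k)) ≤ R := by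
    intro u
    by_cases hu : u ∈ A
    · obtain ⟨k, h1, h2⟩ := hu; exact ⟨k, fun _ => ⟨h1, h2⟩⟩
    · exact ⟨0, fun h => absurd h hu⟩
  have hkB : ∀ u, ∃ k, u ∈ B → i + k ≤ N ∧ wdist S u (α (i + k)) ≤ R := by
    intro u
    by_cases hu : u ∈ B
    · obtain ⟨k, h1, h2⟩ := hu; exact ⟨k, fun _ => ⟨h1, h2⟩⟩
    · exact ⟨0, fun h => absurd h hu⟩
  choose kA hkA using hkA
  choose kB hkB using hkB
  have hsA := hsum A (fun k => α (i - k)) kA fun u hu => (hkA u hu).2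
  have hsB := hsum B (fun k => α (i + k)) kB fun u hu => (hkB u hu).2
  set Gx := Gr m Δ (α 0) (α i) with hGx
  set Gy := Gr m Δ (α i) (α N) with hGy
  have hterm : ∀ u' ∈ B, ∀ u ∈ A, Gr m Δ (α 0) u * Dt m O u u' * Gr m Δ u' (α N) ≤
      (C1 * cR * cR * (Gx * Gy) * 2⁻¹ ^ kB u') * 2⁻¹ ^ kA u := by
    intro u' hu' u hu
    obtain ⟨a1, a2⟩ := hkA u hu
    obtain ⟨b1, b2⟩ := hkB u' hu'
    have h1 := hcon _ hx u (i - kA u) (by omega) a2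
    have h2 := hcon _ hy u' (i + kB u') b1 b2
    have e1 : Nat.dist (i - kA u) i = kA u := by simp only [Nat.dist]; omega
    have e2 : Nat.dist (i + kB u') i = kB u' := by simp only [Nat.dist]; omega
    have e3 : Nat.dist (i - kA u) (i + kB u') = kA u + kB u' := by simp only [Nat.dist]; omega
    rw [e1] at h1
    rw [e2] at h2
    have h3 := Dt_bound hS hδ ht m hm hν0 hν1 hgap M' hM' hα O hOw u u' (i - kA u) (i + kB u')
      (by omega) b1 a2 b2
    rw [e3] at h3
    calc Gr m Δ (α 0) u * Dt m O u u' * Gr m Δ u' (α N)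
        ≤ Gr m Δ (α 0) u * (C1 * (q * 2⁻¹) ^ (kA u + kB u')) * Gr m Δ u' (α N) := by
          gcongr
      _ = C1 * 2⁻¹ ^ kB u' * 2⁻¹ ^ kA u * (q ^ kA u * Gr m Δ (α 0) u) *
          (q ^ kB u' * Gr m Δ u' (α N)) := by
          rw [mul_pow, pow_add, pow_add]; ring
      _ ≤ C1 * 2⁻¹ ^ kB u' * 2⁻¹ ^ kA u * (cR * Gx) * (cR * Gy) := by gcongr
      _ = _ := by ring
  refine hdec.trans ?_
  have hin : ∀ u', B.indicator (fun u' => (∑' u, A.indicator (Gr m Δ (α 0)) u *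
      Dt m O u u') * Gr m Δ u' (α N)) u' ≤
      (C1 * cR * cR * (Gx * Gy) * β) * B.indicator (fun u => (2⁻¹ : ℝ≥0∞) ^ kB u) u' := by
    intro u'
    by_cases hu' : u' ∈ B
    · rw [Set.indicator_of_mem hu', Set.indicator_of_mem hu', ← ENNReal.tsum_mul_right]
      calc ∑' u, A.indicator (Gr m Δ (α 0)) u * Dt m O u u' * Gr m Δ u' (α N)
          ≤ ∑' u, (C1 * cR * cR * (Gx * Gy) * 2⁻¹ ^ kB u') *
              A.indicator (fun u => (2⁻¹ : ℝ≥0∞) ^ kA u) u := by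
            refine ENNReal.tsum_le_tsum fun u => ?_
            by_cases hu : u ∈ A
            · rw [Set.indicator_of_mem hu, Set.indicator_of_mem hu]
              exact hterm u' hu' u hu
            · simp [Set.indicator_of_notMem hu]
        _ = (C1 * cR * cR * (Gx * Gy) * 2⁻¹ ^ kB u') *
              ∑' u, A.indicator (fun u => (2⁻¹ : ℝ≥0∞) ^ kA u) u := ENNReal.tsum_mul_left
        _ ≤ (C1 * cR * cR * (Gx * Gy) * 2⁻¹ ^ kB u') * β := by gcongr
        _ = _ := by ring
    · simp [Set.indicator_of_notMem hu']
  refine (ENNReal.tsum_le_tsum hin).trans ?_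
  rw [ENNReal.tsum_mul_left]
  calc (C1 * cR * cR * (Gx * Gy) * β) * ∑' u', B.indicator (fun u => (2⁻¹ : ℝ≥0∞) ^ kB u) u'
      ≤ (C1 * cR * cR * (Gx * Gy) * β) * β := by gcongr
    _ = C1 * cR * cR * β * β * (Gx * Gy) := by ring
    _ ≤ _ := by gcongr; exact le_self_add

theorem green_multiplicativity
    (Γ : Type) [Group Γ] (S : Set Γ) (δ : ℝ)
    (hS : IsGenSet S) (hδ : IsHyperbolic S δ) (hne : Nonelementary Γ)
    (μ : Γ → ℝ) (hμ : IsRWMeasure S μ) :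
    ∃ R0 : ℝ, 0 < R0 ∧ ∃ C : ℝ, 1 ≤ C ∧
      ∀ (x y v : Γ) (α : ℕ → Γ) (Δ : Set Γ), IsGeodesicSeg S x y α →
        (∃ i ≤ wdist S x y, α i = v) → segN S x y α R0 ⊆ Δ →
        greenR μ Δ x y ≤ C * greenFR μ Δ x v * greenR μ Δ v y := by
  classical
  obtain ⟨Cg, lam, hCg, hl0, hl1, hgap⟩ := spectral_gap hS hδ hne hμ
  set m : Γ → ℝ≥0∞ := fun g => ENNReal.ofReal (μ g) with hmdef
  have hF : ∀ g, μ g ≠ 0 → g ∈ hS.1.toFinset := fun g hg => by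
    simpa using hμ.support_subset g hg
  have hKr := Kr_eq hS.1.toFinset hμ.nonneg hF
  have hbd : ∀ Δ n x y, ptransR μ Δ n x y ≤ Cg * lam ^ n := by
    intro Δ n x y
    have h1 := Kr_mono m (Set.subset_univ Δ) n x y
    rw [hKr, hKr, ptransR_univ] at h1
    have hpos : 0 ≤ Cg * lam ^ n := by positivity
    have h2 := h1.trans (ENNReal.ofReal_le_ofReal (hgap n x y))
    exact (ENNReal.ofReal_le_ofReal_iff hpos).1 h2
  have hgeo : Summable fun n : ℕ => Cg * lam ^ n :=
    (summable_geometric_of_lt_one hl0.le hl1).mul_left _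
  have hsm : ∀ Δ x y, Summable fun n => ptransR μ Δ n x y := fun Δ x y =>
    Summable.of_nonneg_of_le (fun n => ptransR_nonneg hμ.nonneg Δ n x y)
      (fun n => hbd Δ n x y) hgeo
  have hGr : ∀ Δ x y, Gr m Δ x y = ENNReal.ofReal (greenR μ Δ x y) := by
    intro Δ x y
    unfold Gr greenR
    rw [ENNReal.ofReal_tsum_of_nonneg (fun n => ptransR_nonneg hμ.nonneg Δ n x y) (hsm Δ x y)]
    exact tsum_congr fun n => hKr Δ n x y
  have hg0 : ∀ Δ x y, 0 ≤ greenR μ Δ x y := fun Δ x y =>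
    tsum_nonneg fun n => ptransR_nonneg hμ.nonneg Δ n x y
  set G0 := ∑' n : ℕ, Cg * lam ^ n with hG0
  have hgG : ∀ Δ x y, greenR μ Δ x y ≤ G0 := fun Δ x y =>
    (hsm Δ x y).tsum_le_tsum (fun n => hbd Δ n x y) hgeo
  have hsq : 0 < √lam := Real.sqrt_pos.2 hl0
  have hsq1 : √lam < 1 := by rw [Real.sqrt_lt' one_pos]; simpa using hl1
  obtain ⟨R0, C, hC, hanc⟩ := ancona hS hδ m
    (fun g hg => hμ.support_subset g fun h => hg (by simp [hmdef, h]))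
    (fun g => by
      obtain ⟨l, -, h1, h2⟩ := hμ.nondeg g
      exact ⟨l, fun x hx => by simpa [hmdef] using h1 x hx, h2⟩)
    (Cg := ENNReal.ofReal Cg) (ν := ENNReal.ofReal √lam) ENNReal.ofReal_ne_top
    (by simpa using hl0) (by rw [← ENNReal.ofReal_one]; exact (ENNReal.ofReal_lt_ofReal_iff one_pos).2 hsq1)
    (fun n x y => by
      rw [hKr, ptransR_univ, ← mul_pow, ← ENNReal.ofReal_mul hsq.le, Real.mul_self_sqrt hl0.le,
        ← ENNReal.ofReal_pow hl0.le, ← ENNReal.ofReal_mul hCg.le]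
      exact ENNReal.ofReal_le_ofReal (hgap n x y))
  refine ⟨R0 + 1, by positivity, max 1 (C.toReal * G0), le_max_left _ _, ?_⟩
  rintro x y v α Δ ⟨hα0, hα1, hα2⟩ ⟨i, hi, rfl⟩ hΔ
  have hmain := hanc (wdist S x y) α Δ i hi hα2 (by
    intro j hj g hg
    refine hΔ ⟨j, hj, ?_⟩
    have : (wdist S g (α j) : ℝ) ≤ R0 := by exact_mod_cast hg
    linarith)
  rw [hα0, hα1, hGr, hGr, hGr, ← ENNReal.ofReal_toReal hC,
    ← ENNReal.ofReal_mul (hg0 _ _ _), ← ENNReal.ofReal_mul ENNReal.toReal_nonneg,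
    ENNReal.ofReal_le_ofReal_iff (mul_nonneg ENNReal.toReal_nonneg
      (mul_nonneg (hg0 _ _ _) (hg0 _ _ _)))] at hmain
  have hv : α i ∈ Δ := hΔ ⟨i, hi, by rw [wdist_self]; push_cast; positivity⟩
  have h1 : 1 ≤ greenR μ Δ (α i) (α i) := by
    have := one_le_Gr m Δ (α i) hv
    rw [hGr] at this
    exact ENNReal.one_le_ofReal.1 this
  have h2 := hgG Δ (α i) (α i)
  unfold greenFR
  set a := greenR μ Δ x (α i)
  set b := greenR μ Δ (α i) y
  set c := greenR μ Δ (α i) (α i)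
  have ha : 0 ≤ a := hg0 _ _ _
  have hb : 0 ≤ b := hg0 _ _ _
  have hc : 0 < c := by linarith
  have h3 : a ≤ G0 * (a / c) := by
    rw [← mul_div_assoc, le_div_iff₀ hc]
    nlinarith
  calc greenR μ Δ x y ≤ C.toReal * (a * b) := hmain
    _ ≤ C.toReal * ((G0 * (a / c)) * b) := by gcongr
    _ = (C.toReal * G0) * (a / c) * b := by ring
    _ ≤ _ := by gcongr; exact le_max_right _ _

end HarmonicBoundary
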